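/- Let p be a regular prime (p odd and p does not divide the class number of Q(ζ_p)) and N a prime with N ≡ 1 (mod p). Let F = Q(N^{1/p}) and L = Q(ζ_p, N^{1/p}). Then rk_p(Cl(L)) ≥ 2·rk_p(Cl(F)) + (p-7)/2. -/

import Mathlib

open NumberField Polynomial

/-- The `p`-rank of a finite abelian group `G`: the `𝔽_p`-dimension of `G ⊗ 𝔽_p`,
equivalently of `G[p]`. -/
noncomputable def pRank (p : ℕ) (G : Type*) [Group G] : ℕ :=
  (Nat.card {g : G // g ^ p = 1}).factorization p


set_option linter.all false
section
open Module

namespace Kum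

theorem finrank_map_add_ker {k B : Type*} [Field k] [AddCommGroup B] [Module k B]
    [FiniteDimensional k B] (f : Module.End k B) (S : Submodule k B) :
    finrank k (S.map f) + finrank k ↥(S ⊓ LinearMap.ker f) = finrank k S := by
  have h := LinearMap.finrank_range_add_finrank_ker (f.domRestrict S)
  rw [LinearMap.range_domRestrict] at h
  rw [← h]
  congr 1
  rw [LinearMap.ker_domRestrict, ← Submodule.finrank_map_subtype_eq, Submodule.map_comap_subtype]

/-- For a cyclic module `S` generated by `w` under `δ`. -/
theorem cyc_aux {k B : Type*} [Field k] [AddCommGroup B] [Module k B]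
    [FiniteDimensional k B] (δ : Module.End k B) (w : B) (c : k) (i : ℕ) :
    (δ ^ i) w - c ^ i • w ∈
      (Submodule.span k (Set.range fun i : ℕ => (δ ^ i) w)).map (δ - c • (1 : Module.End k B)) := by
  set S := Submodule.span k (Set.range fun i : ℕ => (δ ^ i) w)
  induction i with
  | zero => simp
  | succ n ih =>
    have h1 : (δ ^ (n+1)) w - c ^ (n+1) • w
        = (δ - c • (1 : Module.End k B)) ((δ ^ n) w) + c • ((δ ^ n) w - c ^ n • w) := by
      rw [pow_succ' δ, pow_succ' c]
      simp only [Module.End.mul_apply, LinearMap.sub_apply, LinearMap.smul_apply,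
        Module.End.one_apply, smul_sub, mul_smul]
      abel
    rw [h1]
    refine Submodule.add_mem _ (Submodule.mem_map_of_mem ?_) (Submodule.smul_mem _ _ ih)
    exact Submodule.subset_span ⟨n, rfl⟩

theorem cyc_ker_le {k B : Type*} [Field k] [AddCommGroup B] [Module k B]
    [FiniteDimensional k B] (δ : Module.End k B) (w : B) (c : k) :
    finrank k ↥((Submodule.span k (Set.range fun i : ℕ => (δ ^ i) w)) ⊓
      LinearMap.ker (δ - c • (1 : Module.End k B))) ≤ 1 := by
  have h1 := finrank_map_add_ker (δ - c • (1 : Module.End k B))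
    (Submodule.span k (Set.range fun i : ℕ => (δ ^ i) w))
  have h2 : Submodule.span k (Set.range fun i : ℕ => (δ ^ i) w) ≤
    (Submodule.span k (Set.range fun i : ℕ => (δ ^ i) w)).map (δ - c • (1 : Module.End k B))
      ⊔ Submodule.span k {w} := by
    rw [Submodule.span_le]
    rintro _ ⟨i, rfl⟩
    have := cyc_aux δ w c i
    have h3 : (δ ^ i) w = ((δ ^ i) w - c ^ i • w) + c ^ i • w := by abel
    simp only [SetLike.mem_coe]
    rw [h3]
    exact Submodule.add_mem_sup this
      (Submodule.smul_mem _ _ (Submodule.mem_span_singleton_self w))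
  have h3 := Submodule.finrank_mono h2
  have h4 := Submodule.finrank_add_le_finrank_add_finrank
    ((Submodule.span k (Set.range fun i : ℕ => (δ ^ i) w)).map (δ - c • (1 : Module.End k B)))
    (Submodule.span k {w})
  have h5 := (finrank_span_le_card (R := k) ({w} : Set B))
  simp only [Set.toFinset_singleton, Finset.card_singleton] at h5
  omega

theorem cyc_ker_zero {k B : Type*} [Field k] [AddCommGroup B] [Module k B]
    [FiniteDimensional k B] (δ : Module.End k B) (w : B) (n : ℕ) (hn : (n : k) ≠ 0)
    (hw : ∑ i ∈ Finset.range n, (δ ^ i) w = 0) :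
    (Submodule.span k (Set.range fun i : ℕ => (δ ^ i) w)) ⊓ LinearMap.ker (δ - 1) = ⊥ := by
  have h1 := finrank_map_add_ker (δ - (1:k) • (1 : Module.End k B))
    (Submodule.span k (Set.range fun i : ℕ => (δ ^ i) w))
  set R := (Submodule.span k (Set.range fun i : ℕ => (δ ^ i) w)).map
    (δ - (1:k) • (1 : Module.End k B)) with hR
  have hw' : w ∈ R := by
    have : ∑ i ∈ Finset.range n, ((δ ^ i) w - (1:k) ^ i • w) ∈ R :=
      Submodule.sum_mem _ fun i _ => cyc_aux δ w 1 i
    rw [Finset.sum_sub_distrib, hw] at this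
    simp only [one_pow, one_smul, Finset.sum_const, Finset.card_range, zero_sub,
      neg_mem_iff] at this
    rw [← Nat.cast_smul_eq_nsmul k] at this
    exact (Submodule.smul_mem_iff _ hn).1 this
  have h2 : Submodule.span k (Set.range fun i : ℕ => (δ ^ i) w) ≤ R := by
    rw [Submodule.span_le]
    rintro _ ⟨i, rfl⟩
    have := Submodule.add_mem _ (cyc_aux δ w 1 i) hw'
    rwa [one_pow, one_smul k w, sub_add_cancel] at this
  have h3 := Submodule.finrank_mono h2
  rw [one_smul] at h1
  apply Submodule.finrank_eq_zero.1
  omega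

open Polynomial in
theorem U_ker (p : ℕ) [Fact p.Prime] (hp2 : 2 < p) {B : Type*} [AddCommGroup B]
    [Module (ZMod p) B] (σ : Module.End (ZMod p) B) (hσ : σ ^ p = 1) (x : B)
    (hx : (∑ a : (ZMod p)ˣ, ((a⁻¹ : (ZMod p)ˣ) : ZMod p) • σ ^ (a : ZMod p).val) x = 0) :
    (σ - 1) x = 0 := by
  set P : (ZMod p)[X] := ∑ a : (ZMod p)ˣ, C ((a⁻¹ : (ZMod p)ˣ) : ZMod p) * X ^ (a : ZMod p).val
    with hP
  have hPσ : aeval σ P = ∑ a : (ZMod p)ˣ, ((a⁻¹ : (ZMod p)ˣ) : ZMod p) • σ ^ (a : ZMod p).val := by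
    rw [hP, map_sum]
    refine Finset.sum_congr rfl fun a _ => ?_
    rw [map_mul, aeval_C, map_pow, aeval_X, ← Algebra.smul_def]
  have hP1 : P.eval 1 = 0 := by
    rw [hP, eval_finsetSum]
    simp only [eval_mul, eval_C, eval_pow, eval_X, one_pow, mul_one]
    rw [← Equiv.sum_comp (Equiv.inv (ZMod p)ˣ)]
    simp only [Equiv.inv_apply, inv_inv]
    have := FiniteField.sum_pow_units (ZMod p) 1
    simp only [pow_one] at this
    rw [this, if_neg]
    rw [ZMod.card]
    intro h
    have := Nat.le_of_dvd one_pos h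
    omega
  have hP' : (derivative P).eval 1 = -1 := by
    rw [hP, derivative_sum, eval_finsetSum]
    have : ∀ a : (ZMod p)ˣ, eval 1 (derivative (C ((a⁻¹ : (ZMod p)ˣ) : ZMod p) *
        X ^ (a : ZMod p).val)) = 1 := by
      intro a
      rw [derivative_C_mul, derivative_X_pow, eval_mul, eval_C, eval_mul, eval_C, eval_pow, eval_X,
        one_pow, mul_one, ZMod.natCast_zmod_val, ← Units.val_mul, inv_mul_cancel, Units.val_one]
    rw [Finset.sum_congr rfl fun a _ => this a]
    simp [ZMod.card_units_eq_totient, Nat.totient_prime (Fact.out : p.Prime),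
      Nat.cast_sub (Fact.out : p.Prime).one_le]
  obtain ⟨G, hG⟩ := dvd_iff_isRoot.2 (show IsRoot P 1 from hP1)
  have hG1 : G.eval 1 = -1 := by
    rw [hG] at hP'
    simpa [derivative_mul] using hP'
  have hcop : IsCoprime G ((X - C 1) ^ p) := by
    apply IsCoprime.pow_right
    apply IsCoprime.symm
    rw [(irreducible_X_sub_C (1 : ZMod p)).coprime_iff_not_dvd, dvd_iff_isRoot, IsRoot.def, hG1]
    simp
  obtain ⟨a, b, hab⟩ := hcop
  have e1 : aeval σ (a * G + b * (X - C 1) ^ p) = 1 := by rw [hab]; simp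
  have e2 : aeval σ ((X - C 1 : (ZMod p)[X]) ^ p) = 0 := by
    have : (X - C 1 : (ZMod p)[X]) ^ p = X ^ p - 1 := by
      rw [sub_pow_char]; simp
    rw [this]; simp [hσ]
  have e3 : (σ - 1) x = (aeval σ a * aeval σ G) ((σ - 1) x) := by
    rw [map_add, map_mul, map_mul, e2, mul_zero, add_zero] at e1
    rw [e1]; rfl
  rw [e3, Module.End.mul_apply]
  have e4 : aeval σ (X - C 1 : (ZMod p)[X]) = σ - 1 := by simp
  have e5 : (aeval σ G * (σ - 1)) x = 0 := by
    rw [← e4, ← map_mul, mul_comm, ← hG, hPσ]; exact hx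
  rw [Module.End.mul_apply] at e5
  rw [e5, map_zero]

theorem la_main (p : ℕ) [Fact p.Prime] (hp2 : 2 < p) {B : Type*} [AddCommGroup B]
    [Module (ZMod p) B] [FiniteDimensional (ZMod p) B] (σ δ : Module.End (ZMod p) B)
    (g : (ZMod p)ˣ) (hg : g ≠ 1) (hσ : σ ^ p = 1)
    (hδσ : δ * σ = σ ^ (g : ZMod p).val * δ) (w : B)
    (hw : ∑ i ∈ Finset.range (p - 1), (δ ^ i) w = 0)
    (hS : p ≤ 2 * finrank (ZMod p)
      (Submodule.span (ZMod p) (Set.range fun i : ℕ => (δ ^ i) w)) + 3)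
    (hm : finrank (ZMod p) ↥(LinearMap.ker (σ - 1) ⊓ LinearMap.ker (δ - 1)) ≤ 1) :
    4 * finrank (ZMod p) (LinearMap.ker (δ - 1)) + p ≤ 2 * finrank (ZMod p) B + 7 := by
  set S := Submodule.span (ZMod p) (Set.range fun i : ℕ => (δ ^ i) w) with hSdef
  set B0 := LinearMap.ker (δ - 1) with hB0
  set B1 := LinearMap.ker (δ - (g : ZMod p) • (1 : Module.End (ZMod p) B)) with hB1
  set U : Module.End (ZMod p) B :=
    ∑ a : (ZMod p)ˣ, ((a⁻¹ : (ZMod p)ˣ) : ZMod p) • σ ^ (a : ZMod p).val with hU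
  have hδx : ∀ x ∈ B0, δ x = x := by
    intro x hx
    have : δ x - x = 0 := by simpa [hB0] using hx
    exact sub_eq_zero.1 this
  have hσmod : ∀ n : ℕ, σ ^ (n % p) = σ ^ n := by
    intro n
    conv_rhs => rw [← Nat.mod_add_div n p, pow_add, pow_mul, hσ, one_pow, mul_one]
  have hδσn : ∀ n : ℕ, δ * σ ^ n = σ ^ ((g : ZMod p).val * n) * δ := by
    intro n
    induction n with
    | zero => simp
    | succ n ih =>
      rw [pow_succ, ← mul_assoc, ih, mul_assoc, hδσ, ← mul_assoc, ← pow_add, mul_add, mul_one]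
  have hUB : B0.map U ≤ B1 := by
    rintro _ ⟨x, hx, rfl⟩
    have hx' := hδx x hx
    have : δ (U x) = (g : ZMod p) • U x := by
      rw [hU, LinearMap.sum_apply, map_sum, Finset.smul_sum,
        ← Equiv.sum_comp (Equiv.mulLeft g) (fun a => (g : ZMod p) •
          ((((a⁻¹ : (ZMod p)ˣ) : ZMod p) • σ ^ (a : ZMod p).val : Module.End (ZMod p) B) x))]
      refine Finset.sum_congr rfl fun a _ => ?_
      simp only [Equiv.coe_mulLeft, LinearMap.smul_apply, map_smul]
      rw [← Module.End.mul_apply, hδσn, Module.End.mul_apply, hx', smul_smul]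
      congr 1
      · rw [← Units.val_mul, mul_inv, mul_inv_cancel_left]
      · rw [Units.val_mul, ZMod.val_mul, hσmod]
    simp [hB1, this]
  have h1 := finrank_map_add_ker U B0
  have h2 : B0 ⊓ LinearMap.ker U ≤ LinearMap.ker (σ - 1) ⊓ B0 := by
    rintro x ⟨hx0, hxU⟩
    exact ⟨U_ker p hp2 σ hσ x hxU, hx0⟩
  have h3 := Submodule.finrank_mono h2
  have hgne : (g : ZMod p) - 1 ≠ 0 := by
    rw [sub_ne_zero]
    intro h; exact hg (Units.ext h)
  have hδ1x : ∀ x ∈ B1, δ x = (g : ZMod p) • x := by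
    intro x hx
    have : δ x - (g : ZMod p) • x = 0 := by simpa [hB1] using hx
    exact sub_eq_zero.1 this
  have h01 : B0 ⊓ B1 = ⊥ := by
    rw [eq_bot_iff]
    rintro x ⟨hx0, hx1⟩
    have e1 := hδx x hx0
    have e2 := hδ1x x hx1
    rw [e1] at e2
    have : ((g : ZMod p) - 1) • x = 0 := by rw [sub_smul, one_smul, ← e2, sub_self]
    exact (smul_eq_zero.1 this).resolve_left hgne
  have h4 := Submodule.finrank_sup_add_finrank_inf_eq B0 (B0.map U)
  have h5 : B0 ⊓ B0.map U = ⊥ := eq_bot_iff.2 (h01 ▸ inf_le_inf_left _ hUB)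
  rw [h5, finrank_bot] at h4
  have h6 := Submodule.finrank_sup_add_finrank_inf_eq S (B0 ⊔ B0.map U)
  have h7 : finrank (ZMod p) ↥(S ⊓ (B0 ⊔ B0.map U)) ≤ 1 := by
    have a1 := finrank_map_add_ker (δ - 1) (S ⊓ (B0 ⊔ B0.map U))
    have a2 : S ⊓ (B0 ⊔ B0.map U) ⊓ LinearMap.ker (δ - 1) = ⊥ := by
      rw [eq_bot_iff, ← cyc_ker_zero δ w (p - 1) ?_ hw]
      · exact inf_le_inf_right _ inf_le_left
      · rw [Nat.cast_sub (Fact.out : p.Prime).one_le]; simp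
    rw [a2, finrank_bot, add_zero] at a1
    rw [← a1]
    refine le_trans (Submodule.finrank_mono ?_) (cyc_ker_le δ w (g : ZMod p))
    rintro _ ⟨x, ⟨hxS, hx⟩, rfl⟩
    refine ⟨?_, ?_⟩
    · have hSδ : S ≤ S.comap δ := by
        rw [hSdef, Submodule.span_le]
        rintro _ ⟨i, rfl⟩
        refine Submodule.subset_span ⟨i + 1, ?_⟩
        simp only [pow_succ']; rfl
      exact Submodule.sub_mem _ (hSδ hxS) hxS
    · obtain ⟨y, hy, z, hz, rfl⟩ := Submodule.mem_sup.1 hx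
      have hz1 := hUB hz
      have e : (δ - 1) (y + z) = ((g : ZMod p) - 1) • z := by
        simp only [LinearMap.sub_apply, map_add, Module.End.one_apply, hδx y hy, hδ1x z hz1,
          sub_smul, one_smul]
        abel
      rw [e]
      exact Submodule.smul_mem _ _ hz1
  have h8 := Submodule.finrank_le (S ⊔ (B0 ⊔ B0.map U))
  omega

end Kum

end

section
open Module

namespace Kum

open Polynomial in
theorem prod_one_sub_pow_poly (p : ℕ) (hp : p.Prime) :
    (∑ i ∈ Finset.range p, (X : ℤ[X]) ^ i) ∣
      (∏ k ∈ Finset.range (p - 1), (1 - (X : ℤ[X]) ^ (k + 1))) - C (p : ℤ) := by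
  haveI : Fact p.Prime := ⟨hp⟩
  have hμ := Complex.isPrimitiveRoot_exp p hp.ne_zero
  rw [← cyclotomic_prime ℤ p, cyclotomic_eq_minpoly hμ hp.pos]
  apply minpoly.isIntegrallyClosed_dvd (hμ.isIntegral hp.pos)
  have hp1 : p = (p - 1) + 1 := (Nat.sub_add_cancel hp.one_le).symm
  have h2 := IsPrimitiveRoot.prod_one_sub_pow_eq_order (n := p - 1)
    (μ := Complex.exp (2 * Real.pi * Complex.I / p)) (by rw [← hp1]; exact hμ)
  rw [map_sub, map_prod]
  simp only [map_sub, map_one, map_pow, aeval_X, aeval_C]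
  rw [h2]
  simp [Nat.cast_sub hp.one_le]

theorem card_quot_free (p : ℕ) (hp : p.Prime) {M : Type*} [AddCommGroup M] [Module.Free ℤ M]
    [Module.Finite ℤ M] (σ : Module.End ℤ M) (hN : ∑ i ∈ Finset.range p, σ ^ i = 0) (r : ℕ)
    (hr : finrank ℤ M ≤ (p - 1) * r) :
    Finite (M ⧸ LinearMap.range (1 - σ)) ∧ Nat.card (M ⧸ LinearMap.range (1 - σ)) ≤ p ^ r := by
  have hprod : (∏ k ∈ Finset.range (p - 1), LinearMap.det (1 - σ ^ (k + 1))) =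
      (p : ℤ) ^ finrank ℤ M := by
    obtain ⟨Q, hQ⟩ := prod_one_sub_pow_poly p hp
    have h1 := congrArg (Polynomial.aeval σ) hQ
    rw [map_mul, map_sum] at h1
    simp only [map_pow, Polynomial.aeval_X] at h1
    rw [hN, zero_mul, map_sub, sub_eq_zero, Polynomial.aeval_C] at h1
    have h2 : ∀ n : ℕ, LinearMap.det (Polynomial.aeval σ
        (∏ k ∈ Finset.range n, (1 - (Polynomial.X : Polynomial ℤ) ^ (k + 1)))) =
        ∏ k ∈ Finset.range n, LinearMap.det (1 - σ ^ (k + 1)) := by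
      intro n
      induction n with
      | zero => simp
      | succ n ih =>
        rw [Finset.prod_range_succ, map_mul, map_mul, ih, Finset.prod_range_succ]
        simp
    rw [← h2, h1, Algebra.algebraMap_eq_smul_one, LinearMap.det_smul]
    simp
  have hdvd : ∀ k, LinearMap.det (1 - σ) ∣ LinearMap.det (1 - σ ^ (k + 1)) := by
    intro k
    refine ⟨LinearMap.det (∑ i ∈ Finset.range (k + 1), σ ^ i), ?_⟩
    rw [← map_mul, mul_neg_geom_sum]
  have hd : LinearMap.det (1 - σ) ^ (p - 1) ∣ (p : ℤ) ^ finrank ℤ M := by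
    rw [← hprod]
    calc LinearMap.det (1 - σ) ^ (p - 1)
        = ∏ k ∈ Finset.range (p - 1), LinearMap.det (1 - σ) := by simp
      _ ∣ _ := Finset.prod_dvd_prod_of_dvd _ _ fun k _ => hdvd k
  have hp0 : (p : ℤ) ^ finrank ℤ M ≠ 0 := pow_ne_zero _ (by exact_mod_cast hp.ne_zero)
  have hp1 : p - 1 ≠ 0 := by have := hp.two_le; omega
  have hdet : LinearMap.det (1 - σ) ≠ 0 := by
    intro h
    rw [h, zero_pow hp1] at hd
    exact hp0 (zero_dvd_iff.1 hd)
  have hinj : Function.Injective (1 - σ : Module.End ℤ M) := by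
    rw [injective_iff_map_eq_zero]
    intro x hx
    have hx' : σ x = x := by
      have : x - σ x = 0 := by simpa using hx
      exact (sub_eq_zero.1 this).symm
    have hxi : ∀ i : ℕ, (σ ^ i) x = x := by
      intro i
      induction i with
      | zero => simp
      | succ i ih => rw [pow_succ, Module.End.mul_apply, hx', ih]
    have h1 : (∑ i ∈ Finset.range p, σ ^ i) x = 0 := by rw [hN]; rfl
    rw [LinearMap.sum_apply] at h1
    simp only [hxi, Finset.sum_const, Finset.card_range] at h1
    have h2 : (p : ℤ) • x = 0 := by simpa using h1
    exact (smul_eq_zero.1 h2).resolve_left (by exact_mod_cast hp.ne_zero)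
  have hcard : Nat.card (M ⧸ LinearMap.range (1 - σ)) = (LinearMap.det (1 - σ)).natAbs := by
    have h := Submodule.natAbs_det_equiv (LinearMap.range (1 - σ))
      (LinearEquiv.ofInjective (1 - σ) hinj)
    rw [← h]
    congr 2
  have hne : Nat.card (M ⧸ LinearMap.range (1 - σ)) ≠ 0 := by
    rw [hcard]; exact Int.natAbs_ne_zero.2 hdet
  refine ⟨Nat.finite_of_card_ne_zero hne, ?_⟩
  rw [hcard]
  have h3 : (LinearMap.det (1 - σ)).natAbs ^ (p - 1) ∣ p ^ finrank ℤ M := by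
    have := Int.natAbs_dvd_natAbs.2 hd
    simpa [Int.natAbs_pow] using this
  have h4 := Nat.le_of_dvd (pow_pos hp.pos _) h3
  have h5 : (LinearMap.det (1 - σ)).natAbs ^ (p - 1) ≤ (p ^ r) ^ (p - 1) := by
    refine h4.trans ?_
    rw [← pow_mul, mul_comm r]
    exact Nat.pow_le_pow_right hp.pos hr
  exact (Nat.pow_le_pow_iff_left hp1).1 h5

theorem card_units_bound (p : ℕ) (hp : p.Prime) {E : Type*} [AddCommGroup E]
    [Module.Finite ℤ E] (σ : Module.End ℤ E) (r : ℕ) (t : E)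
    (ht : ∀ x : E, (∃ n : ℤ, n ≠ 0 ∧ n • x = 0) → x ∈ AddSubgroup.zmultiples t)
    (hσ : σ ^ p = 1)
    (hr : finrank ℤ E ≤ finrank ℤ (LinearMap.range (∑ i ∈ Finset.range p, σ ^ i)) + (p - 1) * r)
    {X : Type*} (u : X → E)
    (hu : ∀ x, (∑ i ∈ Finset.range p, σ ^ i) (u x) = 0)
    (hinj : ∀ x y e, u x - u y = e - σ e → x = y) :
    Nat.card X ≤ p ^ (r + 1) := by
  set Nm := ∑ i ∈ Finset.range p, σ ^ i with hNm
  have hcomm : Nm * σ = σ * Nm := by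
    rw [hNm, Finset.sum_mul, Finset.mul_sum]
    exact Finset.sum_congr rfl fun i _ => by rw [← pow_succ, pow_succ']
  set V := LinearMap.ker Nm with hV
  have hσV : ∀ x ∈ V, σ x ∈ V := by
    intro x hx
    rw [hV, LinearMap.mem_ker] at hx ⊢
    rw [← Module.End.mul_apply, hcomm, Module.End.mul_apply, hx, map_zero]
  let σV : Module.End ℤ V := σ.restrict hσV
  have hσVp : ∀ i : ℕ, ∀ x : V, (((σV ^ i) x : V) : E) = (σ ^ i) x := by
    intro i
    induction i with
    | zero => intro x; simp
    | succ i ih =>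
      intro x
      rw [pow_succ', pow_succ', Module.End.mul_apply, Module.End.mul_apply, ← ih]; rfl
  have hNV : ∑ i ∈ Finset.range p, σV ^ i = 0 := by
    ext x
    have hx : Nm (x : E) = 0 := x.2
    rw [hNm, LinearMap.sum_apply] at hx
    rw [LinearMap.sum_apply]
    simp only [AddSubmonoidClass.coe_finsetSum, hσVp]
    simpa using hx
  let T := Submodule.torsion ℤ V
  have hT : T ≤ T.comap σV := by
    intro x hx
    rw [Submodule.mem_torsion_iff] at hx
    obtain ⟨a, ha⟩ := hx
    rw [Submodule.mem_comap, Submodule.mem_torsion_iff]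
    refine ⟨a, ?_⟩
    have : σV (a • x) = 0 := by rw [ha, map_zero]
    have h2 : σV ((a : ℤ) • x) = (a : ℤ) • σV x := map_smul _ _ _
    change (a : ℤ) • σV x = 0
    rw [← h2]; exact this
  let σM : Module.End ℤ (V ⧸ T) := T.mapQ T σV hT
  have hσM : ∀ i : ℕ, ∀ x : V, (σM ^ i) (T.mkQ x) = T.mkQ ((σV ^ i) x) := by
    intro i
    induction i with
    | zero => intro x; simp
    | succ i ih =>
      intro x
      rw [pow_succ', pow_succ', Module.End.mul_apply, Module.End.mul_apply, ih]; rfl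
  have hNM : ∑ i ∈ Finset.range p, σM ^ i = 0 := by
    refine LinearMap.ext fun y => ?_
    obtain ⟨x, rfl⟩ := T.mkQ_surjective y
    rw [LinearMap.sum_apply]
    simp only [hσM]
    rw [← map_sum, ← LinearMap.sum_apply, hNV]; simp
  have hrank : finrank ℤ (V ⧸ T) ≤ (p - 1) * r := by
    have h1 : finrank ℤ (V ⧸ T) ≤ finrank ℤ V := Submodule.finrank_quotient_le T
    have h2 := Submodule.finrank_quotient_add_finrank V
    rw [(LinearMap.quotKerEquivRange Nm).finrank_eq] at h2
    omega
  haveI : Module.IsTorsionFree ℤ (V ⧸ T) := by infer_instance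
  haveI : Module.Free ℤ (V ⧸ T) := Module.free_of_finite_type_torsion_free'
  obtain ⟨hfin, hcard⟩ := card_quot_free p hp σM hNM r hrank
  -- torsion of V is cyclic
  let φ : T →+ AddSubgroup.zmultiples t :=
    { toFun := fun x => ⟨((x : V) : E), ht _ (by
        have := x.2
        rw [Submodule.mem_torsion_iff] at this
        obtain ⟨a, ha⟩ := this
        refine ⟨(a : ℤ), nonZeroDivisors.coe_ne_zero a, ?_⟩
        have h2 := congrArg (Subtype.val : V → E) ha
        exact h2)⟩
      map_zero' := rfl
      map_add' := fun _ _ => rfl }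
  have hφ : Function.Injective φ := by
    intro x y h
    have h1 := congrArg Subtype.val h
    exact Subtype.ext (Subtype.ext h1)
  haveI hcyc : IsAddCyclic T := isAddCyclic_of_injective φ hφ
  obtain ⟨t', ht'⟩ := IsAddCyclic.exists_generator (α := T)
  let uV : X → V := fun x => ⟨u x, hu x⟩
  let Q' := (V ⧸ T) ⧸ LinearMap.range (1 - σM)
  let π : V →ₗ[ℤ] Q' := (LinearMap.range (1 - σM)).mkQ ∘ₗ T.mkQ
  have hker : ∀ v : V, π v = 0 → ∃ (k : ℤ) (e : V), v = k • (t' : V) + (e - σV e) := by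
    intro v hv
    have h1 : T.mkQ v ∈ LinearMap.range (1 - σM) := by
      rw [← Submodule.Quotient.mk_eq_zero]; exact hv
    obtain ⟨y, hy⟩ := h1
    obtain ⟨e, rfl⟩ := T.mkQ_surjective y
    have h2 : T.mkQ (v - (e - σV e)) = 0 := by
      rw [map_sub, ← hy, sub_eq_zero, map_sub]; rfl
    have h3 : v - (e - σV e) ∈ T := by
      rw [← Submodule.Quotient.mk_eq_zero]; exact h2
    obtain ⟨k, hk⟩ := AddSubgroup.mem_zmultiples_iff.1 (ht' ⟨_, h3⟩)
    refine ⟨k, e, ?_⟩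
    have h4 := congrArg (Subtype.val : T → V) hk
    have h5 : k • (t' : V) = v - (e - σV e) := h4
    rw [h5]; abel
  -- p • t' is of the form e - σ e
  have hpt : ∃ e0 : V, (p : ℤ) • (t' : V) = e0 - σV e0 := by
    have h1 : ∀ i : ℕ, ∃ e : V, (t' : V) - (σV ^ i) t' = e - σV e := by
      intro i
      induction i with
      | zero => exact ⟨0, by simp⟩
      | succ i ih =>
        obtain ⟨e, he⟩ := ih
        refine ⟨e + (σV ^ i) t', ?_⟩
        rw [pow_succ', Module.End.mul_apply, map_add]
        have : (t' : V) - σV ((σV ^ i) t') =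
          ((t' : V) - (σV ^ i) t') + ((σV ^ i) t' - σV ((σV ^ i) t')) := by abel
        rw [this, he]; abel
    choose e he using h1
    refine ⟨∑ i ∈ Finset.range p, e i, ?_⟩
    rw [map_sum, ← Finset.sum_sub_distrib, ← Finset.sum_congr rfl fun i _ => he i,
      Finset.sum_sub_distrib, ← LinearMap.sum_apply, hNV]
    simp
  obtain ⟨e0, he0⟩ := hpt
  haveI : Fact p.Prime := ⟨hp⟩
  haveI : Finite Q' := hfin
  classical
  -- representatives of fibres
  let rep : Q' → Option X := fun q => if h : ∃ x, π (uV x) = q then some h.choose else none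
  have hrep : ∀ x : X, ∃ x0 : X, rep (π (uV x)) = some x0 ∧ π (uV x0) = π (uV x) := by
    intro x
    have h : ∃ y, π (uV y) = π (uV x) := ⟨x, rfl⟩
    refine ⟨h.choose, ?_, h.choose_spec⟩
    simp only [rep, dif_pos h]
  choose x0 hx0 hx0' using hrep
  have hk : ∀ x : X, ∃ (k : ℤ) (e : V), uV x - uV (x0 x) = k • (t' : V) + (e - σV e) := by
    intro x
    exact hker _ (by rw [map_sub, hx0', sub_self])
  choose k e hke using hk
  let Φ : X → Q' × ZMod p := fun x => (π (uV x), (k x : ZMod p))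
  have hΦ : Function.Injective Φ := by
    intro x y hxy
    have h1 : π (uV x) = π (uV y) := congrArg Prod.fst hxy
    have h2 : (k x : ZMod p) = (k y : ZMod p) := congrArg Prod.snd hxy
    have h3 : x0 x = x0 y := by
      have h4 := hx0 x
      rw [h1, hx0 y] at h4
      exact (Option.some_injective _ h4).symm
    rw [ZMod.intCast_eq_intCast_iff_dvd_sub] at h2
    obtain ⟨c, hc⟩ := h2
    have h5 : uV x - uV y = (e x - e y - c • e0) - σV (e x - e y - c • e0) := by
      have h6 : uV x - uV y = (uV x - uV (x0 x)) - (uV y - uV (x0 y)) := by rw [h3]; abel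
      have h7 : k x • (t' : V) - k y • (t' : V) = - (c • (e0 - σV e0)) := by
        rw [← he0, ← sub_smul, smul_smul, ← neg_smul]
        congr 1; linarith
      rw [h6, hke x, hke y]
      calc _ = (k x • (t' : V) - k y • (t' : V)) + ((e x - σV (e x)) - (e y - σV (e y))) := by abel
        _ = _ := by rw [h7, map_sub, map_sub, map_smul, smul_sub]; abel
    exact hinj x y _ (congrArg (Subtype.val : V → E) h5)
  calc Nat.card X ≤ Nat.card (Q' × ZMod p) := Nat.card_le_card_of_injective Φ hΦ
    _ = Nat.card Q' * p := by rw [Nat.card_prod, Nat.card_zmod]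
    _ ≤ p ^ r * p := Nat.mul_le_mul_right _ hcard
    _ = p ^ (r + 1) := (pow_succ _ _).symm

end Kum

end

section
open Module
open scoped Pointwise

namespace Kum

section generic
variable {O G : Type*} [CommRing O] [IsDomain O] [IsDedekindDomain O] [CharZero O]
  [Module.Free ℤ O] [Module.Finite ℤ O]
  [Group G] [Finite G] [MulSemiringAction G O] [IsGaloisGroup G ℤ O]

theorem liesOver_of_mem (P : Ideal O) [P.IsPrime] (l : ℕ) (hl : l.Prime) (h : (l : O) ∈ P) :
    P.LiesOver (Ideal.span {(l : ℤ)}) := by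
  have hl' : Prime (l : ℤ) := Nat.prime_iff_prime_int.1 hl
  rw [Ideal.liesOver_span_iff Ideal.IsPrime.ne_top' hl']
  simpa using h

theorem exists_smul_eq (P Q : Ideal O) [P.IsPrime] [Q.IsPrime] (l : ℕ) (hl : l.Prime)
    (h : (l : O) ∈ P) (h' : (l : O) ∈ Q) : ∃ τ : G, τ • P = Q := by
  have := liesOver_of_mem P l hl h
  have := liesOver_of_mem Q l hl h'
  exact Ideal.exists_smul_eq_of_isGaloisGroup (Ideal.span {(l : ℤ)}) P Q G

instance perfect_res (l : ℕ) [Fact l.Prime] [(Ideal.span {(l : ℤ)}).IsPrime] :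
    PerfectField (Ideal.span {(l : ℤ)}).ResidueField := by
  have : (Ideal.span {(l : ℤ)}).IsMaximal := by
    apply Ideal.IsPrime.isMaximal inferInstance
    simp [(Fact.out : l.Prime).ne_zero]
  infer_instance

theorem prime_span (l : ℕ) (hl : l.Prime) : (Ideal.span {(l : ℤ)}).IsPrime := by
  have hl' : Prime (l : ℤ) := Nat.prime_iff_prime_int.1 hl
  exact (Ideal.span_singleton_prime hl'.ne_zero).2 hl'

theorem le_card_inertia (P : Ideal O) [P.IsPrime] (l : ℕ) (hl : l.Prime) (h : (l : O) ∈ P)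
    (n : ℕ) (hn : P ^ n ∣ Ideal.span {(l : O)}) : n ≤ Nat.card (P.inertia G) := by
  have := liesOver_of_mem P l hl h
  have := prime_span l hl
  have : Fact l.Prime := ⟨hl⟩
  have hmap : (Ideal.span {(l : ℤ)}).map (algebraMap ℤ O) = Ideal.span {(l : O)} := by
    rw [Ideal.map_span]; simp
  have h0 : Ideal.span {(l : O)} ≠ ⊥ := by
    simp [hl.ne_zero]
  rw [Ideal.card_inertia_eq_ramificationIdxIn (Ideal.span {(l : ℤ)}) P,
    Ideal.ramificationIdxIn_eq_ramificationIdx (Ideal.span {(l : ℤ)}) P G,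
    Ideal.IsDedekindDomain.ramificationIdx_eq_multiplicity (Ideal.span {(l : ℤ)}) P
      (by rw [hmap]; exact h0), hmap]
  have hPb : P ≠ ⊥ := by
    rintro rfl
    simp [hl.ne_zero] at h
  have hfin : FiniteMultiplicity P (Ideal.span {(l : O)}) :=
    FiniteMultiplicity.of_prime_left (Ideal.prime_of_isPrime hPb inferInstance) h0
  exact hfin.le_multiplicity_of_pow_dvd hn

theorem int_mod_of_stab (P : Ideal O) [P.IsPrime] (l : ℕ) (hl : l.Prime) (h : (l : O) ∈ P)
    (hle : Nat.card (MulAction.stabilizer G P) ≤ Nat.card (P.inertia G)) (x : O) :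
    ∃ a : ℤ, x - a ∈ P := by
  have := liesOver_of_mem P l hl h
  have := prime_span l hl
  have : Fact l.Prime := ⟨hl⟩
  have hPb : P ≠ ⊥ := by
    rintro rfl
    simp [hl.ne_zero] at h
  have : P.IsMaximal := Ideal.IsPrime.isMaximal inferInstance hPb
  have : (Ideal.span {(l : ℤ)}).IsMaximal := by
    apply Ideal.IsPrime.isMaximal inferInstance
    simp [hl.ne_zero]
  have h1 := Ideal.card_stabilizer_eq_card_inertia_mul_finrank (G := G) (Ideal.span {(l : ℤ)}) P
  have h2 : P.inertiaDeg ℤ = 1 := by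
    have hpos : 0 < Nat.card (P.inertia G) := Nat.card_pos
    have hpos2 := P.inertiaDeg_pos ℤ
    rw [h1] at hle
    have : P.inertiaDeg ℤ ≤ 1 := by
      by_contra hcon
      push Not at hcon
      nlinarith
    omega
  rw [Ideal.inertiaDeg_eq_of_isMaximal (Ideal.span {(l : ℤ)}) P] at h2
  letI := Ideal.Quotient.field (Ideal.span {(l : ℤ)})
  obtain ⟨c, hc⟩ := (finrank_eq_one_iff_of_nonzero' (1 : O ⧸ P) one_ne_zero).1 h2
    (Ideal.Quotient.mk P x)
  obtain ⟨a, rfl⟩ := Ideal.Quotient.mk_surjective c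
  refine ⟨a, ?_⟩
  rw [← Ideal.Quotient.eq, ← hc, Algebra.smul_def, mul_one]
  simp

theorem mem_smul_iff (τ : G) (I : Ideal O) (x : O) : τ • x ∈ τ • I ↔ x ∈ I :=
  Ideal.smul_mem_pointwise_smul_iff

theorem smul_span (τ : G) (x : O) : τ • Ideal.span {x} = Ideal.span {τ • x} := by
  rw [Ideal.smul_closure]; simp

theorem smul_dvd (τ : G) (I J : Ideal O) : τ • I ∣ τ • J ↔ I ∣ J := by
  rw [Ideal.dvd_iff_le, Ideal.dvd_iff_le, Ideal.pointwise_smul_le_pointwise_smul_iff]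

theorem smul_ne_bot (τ : G) (I : Ideal O) (h : I ≠ ⊥) : τ • I ≠ ⊥ := by
  intro h1; apply h
  have : τ⁻¹ • τ • I = ⊥ := by rw [h1, Ideal.smul_bot]
  simpa using this

theorem exists_prime_nat_mem (P : Ideal O) [hP : P.IsPrime] (h0 : P ≠ ⊥) :
    ∃ l : ℕ, l.Prime ∧ (l : O) ∈ P := by
  have hne : Ideal.absNorm P ≠ 0 := Ideal.absNorm_eq_zero_iff.not.2 h0
  have hmem : ((Ideal.absNorm P : ℕ) : O) ∈ P := Ideal.absNorm_mem P
  have key : ∀ n : ℕ, n ≠ 0 → (n : O) ∈ P → ∃ l : ℕ, l.Prime ∧ (l : O) ∈ P := by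
    intro n
    induction n using Nat.recOnMul with
    | zero => intro h; exact absurd rfl h
    | one => intro _ h; exact absurd ((Ideal.eq_top_iff_one _).2 (by simpa using h)) hP.ne_top
    | prime q hq => intro _ h; exact ⟨q, hq, h⟩
    | mul a b iha ihb =>
      intro hab h
      rw [Nat.cast_mul] at h
      rcases hP.mem_or_mem h with h | h
      · exact iha (left_ne_zero_of_mul hab) h
      · exact ihb (right_ne_zero_of_mul hab) h
  exact key _ hne hmem

theorem prime_unique (P : Ideal O) [hP : P.IsPrime] (l q : ℕ) (hl : l.Prime) (hq : q.Prime)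
    (h : (l : O) ∈ P) (h' : (q : O) ∈ P) : l = q := by
  by_contra hne
  have hc : IsCoprime (l : ℤ) (q : ℤ) := Nat.isCoprime_iff_coprime.2 ((Nat.coprime_primes hl hq).2 hne)
  obtain ⟨a, b, hab⟩ := hc
  apply hP.ne_top
  rw [Ideal.eq_top_iff_one]
  have : (1 : O) = a * l + b * q := by
    have := congrArg (Int.cast : ℤ → O) hab
    push_cast at this
    exact this.symm
  rw [this]
  exact P.add_mem (P.mul_mem_left _ h) (P.mul_mem_left _ h')

theorem int_mem_iff (P : Ideal O) [hP : P.IsPrime] (l : ℕ) (hl : l.Prime)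
    (h : (l : O) ∈ P) (a : ℤ) : (a : O) ∈ P ↔ (l : ℤ) ∣ a := by
  constructor
  · intro ha
    by_contra hn
    have hc : IsCoprime (l : ℤ) a :=
      ((Nat.prime_iff_prime_int.1 hl).irreducible.coprime_iff_not_dvd).2 hn
    obtain ⟨c, d, hcd⟩ := hc
    apply hP.ne_top
    rw [Ideal.eq_top_iff_one]
    have : (1 : O) = c * l + d * a := by
      have := congrArg (Int.cast : ℤ → O) hcd
      push_cast at this
      exact this.symm
    rw [this]
    exact P.add_mem (P.mul_mem_left _ h) (P.mul_mem_left _ ha)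
  · rintro ⟨b, rfl⟩
    push_cast
    exact P.mul_mem_right _ h

end generic

end Kum

end

section
open Module
open scoped Pointwise

namespace Kum

structure KData (p N : ℕ) (u : (ZMod p)ˣ) {O G : Type*} [CommRing O] [Group G]
    [MulSemiringAction G O] (ζ α : O) (σ δ : G) : Prop where
  hp : p.Prime
  hp2 : 2 < p
  hN : N.Prime
  hNp : N ≠ p
  hmod : N ≡ 1 [MOD p]
  hu : ∀ x : (ZMod p)ˣ, x ∈ Subgroup.zpowers u
  hζ : IsPrimitiveRoot ζ p
  hα : α ^ p = (N : O)
  σζ : σ • ζ = ζ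
  σα : σ • α = ζ * α
  δζ : δ • ζ = ζ ^ (u : ZMod p).val
  δα : δ • α = α
  ext : ∀ τ : G, τ • ζ = ζ → τ • α = α → τ = 1

namespace KData
variable {O G : Type*} [CommRing O] [IsDomain O] [IsDedekindDomain O] [CharZero O]
  [Module.Free ℤ O] [Module.Finite ℤ O]
  [Group G] [Finite G] [MulSemiringAction G O] [IsGaloisGroup G ℤ O]
  {p N : ℕ} {u : (ZMod p)ˣ} {ζ α : O} {σ δ : G} 

section
variable (D : KData p N u ζ α σ δ)
include D

theorem α0 : α ≠ 0 := by
  intro h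
  have := D.hα
  rw [h, zero_pow D.hp.ne_zero] at this
  exact D.hN.ne_zero (by exact_mod_cast this.symm)

theorem ζ0 : ζ ≠ 0 := D.hζ.ne_zero D.hp.ne_zero

theorem ζpow_eq_iff (a b : ℕ) : ζ ^ a = ζ ^ b ↔ (a : ZMod p) = b := by
  have h := D.hζ.eq_orderOf
  rw [ZMod.natCast_eq_natCast_iff]
  have ha := pow_mod_orderOf ζ a
  have hb := pow_mod_orderOf ζ b
  rw [← h] at ha hb
  rw [← ha, ← hb]
  constructor
  · intro h
    exact D.hζ.pow_inj (Nat.mod_lt _ D.hp.pos) (Nat.mod_lt _ D.hp.pos) h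
  · intro h
    have h' : a % p = b % p := h
    rw [h']

theorem ζpow_eq_one_iff (a : ℕ) : ζ ^ a = 1 ↔ p ∣ a := D.hζ.pow_eq_one_iff_dvd a

theorem σpow_ζ (k : ℕ) : σ ^ k • ζ = ζ := by
  induction k with
  | zero => simp
  | succ k ih => rw [pow_succ, mul_smul, D.σζ, ih]

theorem σpow_α (k : ℕ) : σ ^ k • α = ζ ^ k * α := by
  induction k with
  | zero => simp
  | succ k ih => rw [pow_succ, mul_smul, D.σα, smul_mul', D.σpow_ζ, ih]; ring

theorem δpow_α (k : ℕ) : δ ^ k • α = α := by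
  induction k with
  | zero => simp
  | succ k ih => rw [pow_succ, mul_smul, D.δα, ih]

theorem δpow_ζ (k : ℕ) : δ ^ k • ζ = ζ ^ ((u : ZMod p).val ^ k) := by
  induction k with
  | zero => simp
  | succ k ih => rw [pow_succ, mul_smul, D.δζ, smul_pow', ih, ← pow_mul, pow_succ]

theorem ext2 (τ τ' : G) (h : τ • ζ = τ' • ζ) (h' : τ • α = τ' • α) : τ = τ' := by
  have := D.ext (τ'⁻¹ * τ) (by rw [mul_smul, h, inv_smul_smul]) (by rw [mul_smul, h', inv_smul_smul])
  exact (inv_mul_eq_one.1 this).symm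

theorem σp : σ ^ p = 1 := D.ext _ (D.σpow_ζ p) (by rw [D.σpow_α, D.hζ.pow_eq_one, one_mul])

theorem orderu : orderOf u = p - 1 := by
  have : Fact p.Prime := ⟨D.hp⟩
  rw [orderOf_eq_card_of_forall_mem_zpowers D.hu, Nat.card_eq_fintype_card, ZMod.card_units_eq_totient,
    Nat.totient_prime D.hp]

theorem ucast (k : ℕ) : (((u : ZMod p).val ^ k : ℕ) : ZMod p) = ((u ^ k : (ZMod p)ˣ) : ZMod p) := by
  have : Fact p.Prime := ⟨D.hp⟩
  push_cast
  rw [ZMod.natCast_zmod_val]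

theorem δp : δ ^ (p - 1) = 1 := by
  refine D.ext _ ?_ (D.δpow_α _)
  rw [D.δpow_ζ]
  conv_rhs => rw [← pow_one ζ]
  rw [D.ζpow_eq_iff, D.ucast, ← D.orderu, pow_orderOf_eq_one]; simp

theorem δσ : δ * σ = σ ^ (u : ZMod p).val * δ := by
  apply D.ext2
  · rw [mul_smul, mul_smul, D.σζ, D.δζ, smul_pow', D.σpow_ζ]
  · rw [mul_smul, mul_smul, D.σα, D.δα, smul_mul', D.δζ, D.δα, D.σpow_α]

theorem u_ne_one : u ≠ 1 := by
  intro h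
  have := D.orderu
  rw [h, orderOf_one] at this
  have := D.hp2
  omega

/-- every element of order dividing p -/
theorem pow_eq_one (x : O) (hx : x ^ p = 1) : ∃ k < p, x = ζ ^ k := by
  have : NeZero p := ⟨D.hp.ne_zero⟩
  obtain ⟨i, hi, h⟩ := D.hζ.eq_pow_of_pow_eq_one hx
  exact ⟨i, hi, h.symm⟩

theorem τζ (τ : G) : ∃ i < p - 1, τ • ζ = δ ^ i • ζ := by
  have : Fact p.Prime := ⟨D.hp⟩
  obtain ⟨k, hk, h⟩ := D.pow_eq_one (τ • ζ) (by rw [← smul_pow', D.hζ.pow_eq_one, smul_one])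
  have hk0 : (k : ZMod p) ≠ 0 := by
    intro h0
    rw [ZMod.natCast_eq_zero_iff] at h0
    rw [(D.ζpow_eq_one_iff k).2 h0] at h
    have h1 : ζ = 1 := by
      have := congrArg (τ⁻¹ • ·) h
      simpa using this
    have h2 : ζ ^ 1 = 1 := by rw [pow_one, h1]
    rw [D.ζpow_eq_one_iff, Nat.dvd_one] at h2
    exact D.hp.one_lt.ne' h2
  obtain ⟨m, hm⟩ := (Submonoid.mem_powers_iff _ _).1
    ((mem_powers_iff_mem_zpowers).2 (D.hu (Units.mk0 _ hk0)))
  refine ⟨m % (p - 1), Nat.mod_lt _ (by have := D.hp2; omega), ?_⟩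
  rw [h, D.δpow_ζ, D.ζpow_eq_iff, D.ucast, ← D.orderu, pow_mod_orderOf, hm]; simp

theorem τα (τ : G) : ∃ k < p, τ • α = ζ ^ k * α := by
  have h1 : (τ • α) ^ p = α ^ p := by
    rw [← smul_pow', D.hα]; exact map_natCast (MulSemiringAction.toRingHom G O τ) N
  have h2 := D.hζ.pow_sub_pow_eq_prod_sub_mul (τ • α) α D.hp.pos
  rw [h1, sub_self, eq_comm, Finset.prod_eq_zero_iff] at h2
  obtain ⟨x, hx, h3⟩ := h2
  rw [Polynomial.mem_nthRootsFinset D.hp.pos] at hx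
  obtain ⟨k, hk, rfl⟩ := D.pow_eq_one x hx
  exact ⟨k, hk, sub_eq_zero.1 h3⟩

theorem mem_σ (τ : G) (h : τ • ζ = ζ) : ∃ k < p, τ = σ ^ k := by
  obtain ⟨k, hk, h1⟩ := D.τα τ
  exact ⟨k, hk, D.ext2 _ _ (by rw [h, D.σpow_ζ]) (by rw [h1, D.σpow_α])⟩

theorem τ_eq (τ : G) : ∃ i < p - 1, ∃ k < p, τ = δ ^ i * σ ^ k := by
  obtain ⟨i, hi, h⟩ := D.τζ τ
  obtain ⟨k, hk, h1⟩ := D.mem_σ ((δ ^ i)⁻¹ * τ) (by rw [mul_smul, h, inv_smul_smul])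
  exact ⟨i, hi, k, hk, by rw [← h1]; group⟩

theorem δζ_inj (i j : ℕ) (hi : i < p - 1) (hj : j < p - 1) (h : δ ^ i • ζ = δ ^ j • ζ) : i = j := by
  rw [D.δpow_ζ, D.δpow_ζ, D.ζpow_eq_iff, D.ucast, D.ucast, Units.val_inj] at h
  rw [← D.orderu] at hi hj
  exact pow_injOn_Iio_orderOf hi hj h

theorem σpow_inj (i j : ℕ) (hi : i < p) (hj : j < p) (h : σ ^ i = σ ^ j) : i = j := by
  have h1 := D.σpow_α i
  rw [h, D.σpow_α] at h1
  exact D.hζ.pow_inj hi hj (mul_right_cancel₀ D.α0 h1.symm)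

theorem orderσ : orderOf σ = p := by
  have : Fact p.Prime := ⟨D.hp⟩
  apply orderOf_eq_prime D.σp
  intro h
  have := D.σpow_inj 1 0 D.hp.one_lt D.hp.pos (by simpa using h)
  omega

/-- complex conjugation -/
theorem exists_κ : ∃ i : ℕ, (δ ^ i • ζ) * ζ = 1 ∧ (δ ^ i) * σ = σ ^ (p - 1) * δ ^ i := by
  have : Fact p.Prime := ⟨D.hp⟩
  obtain ⟨m, hm⟩ := (Submonoid.mem_powers_iff _ _).1
    ((mem_powers_iff_mem_zpowers).2 (D.hu (-1)))
  have h0 : δ ^ m • ζ = ζ ^ (p - 1) := by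
    rw [D.δpow_ζ, D.ζpow_eq_iff, D.ucast, hm]
    rw [Nat.cast_sub D.hp.one_le]; simp
  refine ⟨m, ?_, ?_⟩
  · rw [h0, ← pow_succ, Nat.sub_add_cancel D.hp.one_le, D.hζ.pow_eq_one]
  · apply D.ext2
    · rw [mul_smul, mul_smul, D.σζ, h0, smul_pow', D.σpow_ζ]
    · rw [mul_smul, mul_smul, D.σα, D.δpow_α, smul_mul', h0, D.δpow_α, D.σpow_α]

end
end KData
end Kum

end

section
open Module
open scoped Pointwise

namespace Kum

section generic
variable {O G : Type*} [CommRing O] [IsDomain O] [IsDedekindDomain O] [CharZero O]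
  [Module.Free ℤ O] [Module.Finite ℤ O]
  [Group G] [Finite G] [MulSemiringAction G O] [IsGaloisGroup G ℤ O]

theorem sqfree_of (I : Ideal O) (h0 : I ≠ ⊥)
    (h : ∀ P : Ideal O, P.IsPrime → P ≠ ⊥ → ¬ P ^ 2 ∣ I) : Squarefree I := by
  rw [squarefree_iff_irreducible_sq_not_dvd_of_ne_zero h0]
  intro P hP hd
  have hP' := hP.prime
  exact h P (Ideal.isPrime_of_prime hP') hP'.ne_zero (by rwa [sq])

theorem dvd_of_sqfree (I J : Ideal O) (hI : Squarefree I) (hJ : J ≠ ⊥)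
    (h : ∀ P : Ideal O, P.IsPrime → P ∣ I → P ∣ J) : I ∣ J := by
  classical
  have hI0 : I ≠ 0 := hI.ne_zero
  rw [UniqueFactorizationMonoid.dvd_iff_normalizedFactors_le_normalizedFactors hI0 hJ]
  rw [UniqueFactorizationMonoid.squarefree_iff_nodup_normalizedFactors hI0] at hI
  rw [Multiset.le_iff_subset hI]
  intro P hP
  have hPp := UniqueFactorizationMonoid.prime_of_normalized_factor P hP
  have := h P (Ideal.isPrime_of_prime hPp) (UniqueFactorizationMonoid.dvd_of_mem_normalizedFactors hP)
  obtain ⟨Q, hQ, ha⟩ := UniqueFactorizationMonoid.exists_mem_normalizedFactors_of_dvd hJ hPp.irreducible this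
  rw [associated_iff_eq] at ha
  rwa [ha]

theorem inv_of_le (I : Ideal O) (h : ∀ τ : G, τ • I ≤ I) (τ : G) : τ • I = I := by
  apply le_antisymm (h τ)
  have := h τ⁻¹
  rwa [← Ideal.subset_pointwise_smul_iff] at this

theorem smul_natCast' (τ : G) (n : ℕ) : τ • (n : O) = n :=
  map_natCast (MulSemiringAction.toRingHom G O τ) n

theorem smul_intCast' (τ : G) (n : ℤ) : τ • (n : O) = n :=
  map_intCast (MulSemiringAction.toRingHom G O τ) n

theorem radical_inv (n : ℕ) (τ : G) :
    τ • (Ideal.span {(n : O)}).radical = (Ideal.span {(n : O)}).radical := by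
  apply inv_of_le
  intro τ x hx
  rw [Ideal.mem_pointwise_smul_iff_inv_smul_mem] at hx
  obtain ⟨k, hk⟩ := hx
  refine ⟨k, ?_⟩
  rw [← smul_pow', ← mem_smul_iff τ, smul_span, smul_natCast', smul_inv_smul] at hk
  exact hk

theorem radical_sqfree (I : Ideal O) (h0 : I ≠ ⊥) : Squarefree I.radical := by
  have hr0 : I.radical ≠ ⊥ := fun h => h0 (le_bot_iff.1 (h ▸ Ideal.le_radical))
  refine sqfree_of _ hr0 ?_
  rintro P hP hPb ⟨A, hA⟩
  have hA0 : A ≠ ⊥ := by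
    rintro rfl
    simp at hA; exact hr0 hA
  have h1 : P * A ≤ P ^ 2 * A := by
    rw [← hA]
    intro x hx
    rw [← Ideal.radical_idem]
    refine ⟨2, ?_⟩
    rw [hA]
    have h2 : x ^ 2 ∈ (P * A) ^ 2 := Ideal.pow_mem_pow hx 2
    rw [mul_pow] at h2
    exact Ideal.mul_mono_right (Ideal.pow_le_self two_ne_zero) h2
  rw [← Ideal.dvd_iff_le, mul_dvd_mul_iff_right hA0, sq] at h1
  have h3 : P ∣ 1 := by
    rw [← mul_dvd_mul_iff_left (a := P) hPb, mul_one]; exact h1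
  exact hP.ne_top (by simpa [Ideal.one_eq_top] using isUnit_of_dvd_one h3)

theorem dvd_radical_iff (n : ℕ) (P : Ideal O) (hP : P.IsPrime) :
    P ∣ (Ideal.span {(n : O)}).radical ↔ (n : O) ∈ P := by
  rw [Ideal.dvd_iff_le, hP.radical_le_iff, Ideal.span_singleton_le_iff_mem]
end generic

namespace KData
variable {O G : Type*} [CommRing O] [IsDomain O] [IsDedekindDomain O] [CharZero O]
  [Module.Free ℤ O] [Module.Finite ℤ O]
  [Group G] [Finite G] [MulSemiringAction G O] [IsGaloisGroup G ℤ O]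
  {p N : ℕ} {u : (ZMod p)ˣ} {ζ α : O} {σ δ : G} 

section
variable (D : KData p N u ζ α σ δ)
include D

theorem prod_one_sub : ∏ k ∈ Finset.range (p - 1), (1 - ζ ^ (k + 1)) = (p : O) := by
  have hp1 : p = (p - 1) + 1 := (Nat.sub_add_cancel D.hp.one_le).symm
  have h2 := IsPrimitiveRoot.prod_one_sub_pow_eq_order (n := p - 1) (μ := ζ)
    (by rw [← hp1]; exact D.hζ)
  rw [h2]; rw [Nat.cast_sub D.hp.one_le]; simp

theorem π_dvd (k : ℕ) : 1 - ζ ∣ 1 - ζ ^ k := by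
  have := sub_dvd_pow_sub_pow (1 : O) ζ k
  simpa using this

theorem πpow_dvd : (1 - ζ) ^ (p - 1) ∣ (p : O) := by
  rw [← D.prod_one_sub]
  calc (1 - ζ) ^ (p - 1) = ∏ k ∈ Finset.range (p - 1), (1 - ζ) := by simp
    _ ∣ _ := Finset.prod_dvd_prod_of_dvd _ _ fun k _ => D.π_dvd _

theorem exists_inv_exp (k : ℕ) (hk : ¬ p ∣ k) : ∃ m, ζ ^ (k * m) = ζ := by
  have : Fact p.Prime := ⟨D.hp⟩
  have hk0 : (k : ZMod p) ≠ 0 := by rwa [Ne, ZMod.natCast_eq_zero_iff]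
  refine ⟨((k : ZMod p)⁻¹).val, ?_⟩
  conv_rhs => rw [← pow_one ζ]
  rw [D.ζpow_eq_iff]
  push_cast
  rw [ZMod.natCast_zmod_val, mul_inv_cancel₀ hk0]

theorem dvd_π (k : ℕ) (hk : ¬ p ∣ k) : 1 - ζ ^ k ∣ 1 - ζ := by
  obtain ⟨m, hm⟩ := D.exists_inv_exp k hk
  have := sub_dvd_pow_sub_pow (1 : O) (ζ ^ k) m
  rwa [one_pow, ← pow_mul, hm] at this

theorem π_ne : (1 - ζ) ≠ 0 := by
  intro h
  have : ζ ^ 1 = 1 := by rw [pow_one]; exact (sub_eq_zero.1 h).symm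
  rw [D.ζpow_eq_one_iff, Nat.dvd_one] at this
  exact D.hp.one_lt.ne' this

theorem π_dvd_p : (1 - ζ) ∣ (p : O) :=
  dvd_trans (dvd_pow_self _ (by have := D.hp2; omega)) D.πpow_dvd

theorem p_mem_iff (P : Ideal O) [hP : P.IsPrime] : (p : O) ∈ P ↔ 1 - ζ ∈ P := by
  constructor
  · intro h
    rw [← D.prod_one_sub, hP.prod_mem_iff] at h
    obtain ⟨k, hk, h⟩ := h
    rw [Finset.mem_range] at hk
    exact P.mem_of_dvd (D.dvd_π (k + 1) (Nat.not_dvd_of_pos_of_lt (by omega) (by omega))) h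
  · exact P.mem_of_dvd D.π_dvd_p

theorem p_mem_of (P : Ideal O) [hP : P.IsPrime] (k : ℕ) (hk : ¬ p ∣ k) (h : ζ ^ k - 1 ∈ P) :
    (p : O) ∈ P := by
  rw [D.p_mem_iff]
  refine P.mem_of_dvd (D.dvd_π k hk) ?_
  rw [← neg_sub]; exact P.neg_mem h

theorem ζ_unit : IsUnit ζ := D.hζ.isUnit D.hp.ne_zero

theorem ζ_not_mem (P : Ideal O) [hP : P.IsPrime] : ζ ∉ P :=
  fun h => hP.ne_top (P.eq_top_of_isUnit_mem h D.ζ_unit)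

theorem eq_of_sub_mem (P : Ideal O) [hP : P.IsPrime] (hpP : (p : O) ∉ P) (a b : ℕ)
    (h : ζ ^ a - ζ ^ b ∈ P) : ζ ^ a = ζ ^ b := by
  wlog hab : b ≤ a generalizing a b
  · exact (this b a (by rw [← neg_sub]; exact P.neg_mem h) (by omega)).symm
  obtain ⟨c, rfl⟩ := Nat.exists_eq_add_of_le hab
  have h1 : ζ ^ b * (ζ ^ c - 1) ∈ P := by convert h using 1; ring
  have h2 : ζ ^ c - 1 ∈ P := (hP.mem_or_mem h1).resolve_left
    fun h => D.ζ_not_mem P (hP.mem_of_pow_mem _ h)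
  by_contra hne
  apply hpP
  refine D.p_mem_of P c ?_ h2
  intro hd
  apply hne
  rw [pow_add, (D.ζpow_eq_one_iff c).2 hd, mul_one]

theorem τζ' (τ : G) : ∃ k, τ • ζ = ζ ^ k := by
  obtain ⟨i, -, h⟩ := D.τζ τ
  exact ⟨_, h.trans (D.δpow_ζ i)⟩

theorem inertia_ζ (P : Ideal O) [hP : P.IsPrime] (hpP : (p : O) ∉ P) (τ : G)
    (h : τ • ζ - ζ ∈ P) : τ • ζ = ζ := by
  obtain ⟨k, hk⟩ := D.τζ' τ
  rw [hk] at h ⊢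
  have := D.eq_of_sub_mem P hpP k 1 (by rwa [pow_one])
  rwa [pow_one] at this

theorem α_mem_iff (P : Ideal O) [hP : P.IsPrime] : α ∈ P ↔ (N : O) ∈ P := by
  rw [← D.hα, hP.pow_mem_iff_mem _ D.hp.pos]

theorem sqfree_l (l : ℕ) (hl : l.Prime) (hlp : l ≠ p) (hlN : l ≠ N) :
    Squarefree (Ideal.span {(l : O)}) := by
  refine sqfree_of _ (by simp [hl.ne_zero]) ?_
  intro P hP hPb hd
  have hlP : (l : O) ∈ P := by
    rw [← Ideal.span_singleton_le_iff_mem, ← Ideal.dvd_iff_le]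
    exact (dvd_pow_self P two_ne_zero).trans hd
  have hpP : (p : O) ∉ P := fun h => hlp (prime_unique P l p hl D.hp hlP h)
  have hNP : (N : O) ∉ P := fun h => hlN (prime_unique P l N hl D.hN hlP h)
  have h2 := le_card_inertia (G := G) P l hl hlP 2 hd
  have h3 : P.inertia G = ⊥ := by
    rw [eq_bot_iff]
    intro τ hτ
    have hτ' : ∀ x, τ • x - x ∈ P := fun x => AddSubgroup.mem_inertia.1 hτ x
    have h4 := D.inertia_ζ P hpP τ (hτ' ζ)
    obtain ⟨k, hk, rfl⟩ := D.mem_σ τ h4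
    have h5 := hτ' α
    rw [D.σpow_α] at h5
    have h6 : (ζ ^ k - 1) * α ∈ P := by convert h5 using 1; ring
    have h7 := (hP.mem_or_mem h6).resolve_right (fun h => hNP ((D.α_mem_iff P).1 h))
    have h8 : ζ ^ k = 1 := by
      by_contra hne
      exact hpP (D.p_mem_of P k (fun h => hne ((D.ζpow_eq_one_iff k).2 h)) h7)
    rw [D.ζpow_eq_one_iff] at h8
    rw [Nat.eq_zero_of_dvd_of_lt h8 hk]; simp
  rw [h3] at h2
  simp at h2

end
end KData
end Kum

end

section
open Module
open scoped Pointwise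

namespace Kum
namespace KData
variable {O G : Type*} [CommRing O] [IsDomain O] [IsDedekindDomain O] [CharZero O]
  [Module.Free ℤ O] [Module.Finite ℤ O]
  [Group G] [Finite G] [MulSemiringAction G O] [IsGaloisGroup G ℤ O]
  {p N : ℕ} {u : (ZMod p)ˣ} {ζ α : O} {σ δ : G} 

section
variable (D : KData p N u ζ α σ δ)
include D

theorem p_not_mem (P : Ideal O) [hP : P.IsPrime] (h : α ∈ P) : (p : O) ∉ P := by
  intro h'
  exact D.hNp (prime_unique P N p D.hN D.hp ((D.α_mem_iff P).1 h) h')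

theorem exists_order_p : ∃ z : ℤ, ¬ (N : ℤ) ∣ z - 1 ∧ (N : ℤ) ∣ z ^ p - 1 := by
  have : Fact N.Prime := ⟨D.hN⟩
  have : Fact p.Prime := ⟨D.hp⟩
  have hd : p ∣ Fintype.card (ZMod N)ˣ := by
    rw [ZMod.card_units_eq_totient, Nat.totient_prime D.hN]
    exact (Nat.modEq_iff_dvd' D.hN.one_le).1 D.hmod.symm
  obtain ⟨y, hy⟩ := exists_prime_orderOf_dvd_card p hd
  refine ⟨((y : ZMod N).val : ℤ), ?_, ?_⟩
  · intro h
    rw [← ZMod.intCast_zmod_eq_zero_iff_dvd] at h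
    push_cast at h
    rw [ZMod.natCast_zmod_val, sub_eq_zero, Units.val_eq_one] at h
    rw [h, orderOf_one] at hy
    exact D.hp.one_lt.ne hy
  · rw [← ZMod.intCast_zmod_eq_zero_iff_dvd]
    push_cast
    rw [ZMod.natCast_zmod_val, sub_eq_zero, ← Units.val_pow_eq_pow_val, ← hy, pow_orderOf_eq_one]
    simp

theorem ζ_int (P : Ideal O) [hP : P.IsPrime] (h : α ∈ P) : ∃ z : ℤ, ζ - z ∈ P := by
  have hNP := (D.α_mem_iff P).1 h
  obtain ⟨z, hz1, hz2⟩ := D.exists_order_p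
  rw [← int_mem_iff P N D.hN hNP] at hz1 hz2
  push_cast at hz1 hz2
  have h1 := D.hζ.pow_sub_pow_eq_prod_sub_mul (z : O) 1 D.hp.pos
  rw [one_pow] at h1
  rw [h1, hP.prod_mem_iff] at hz2
  obtain ⟨x, hx, h3⟩ := hz2
  rw [Polynomial.mem_nthRootsFinset D.hp.pos] at hx
  obtain ⟨k, hk, rfl⟩ := D.pow_eq_one x hx
  rw [mul_one] at h3
  have hk0 : ¬ p ∣ k := by
    intro hd
    rw [(D.ζpow_eq_one_iff k).2 hd] at h3
    exact hz1 h3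
  obtain ⟨m, hm⟩ := D.exists_inv_exp k hk0
  refine ⟨z ^ m, ?_⟩
  have h4 : (z : O) ^ m - (ζ ^ k) ^ m ∈ P := P.mem_of_dvd (sub_dvd_pow_sub_pow _ _ m) h3
  rw [← pow_mul, hm] at h4
  push_cast
  rw [← neg_sub]; exact P.neg_mem h4

theorem stab_ζ (P : Ideal O) [hP : P.IsPrime] (h : α ∈ P) (τ : G) (hτ : τ • P = P) :
    τ • ζ = ζ := by
  obtain ⟨z, hz⟩ := D.ζ_int P h
  apply D.inertia_ζ P (D.p_not_mem P h)
  have h1 : τ • (ζ - z) ∈ τ • P := (mem_smul_iff τ P _).2 hz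
  rw [hτ, smul_sub, smul_intCast'] at h1
  convert P.sub_mem h1 hz using 1; ring

theorem stab_le (P : Ideal O) [hP : P.IsPrime] (h : α ∈ P) :
    MulAction.stabilizer G P ≤ Subgroup.zpowers σ := by
  intro τ hτ
  obtain ⟨k, -, rfl⟩ := D.mem_σ τ (D.stab_ζ P h τ hτ)
  exact Subgroup.npow_mem_zpowers σ k

theorem card_zpowers : Nat.card (Subgroup.zpowers σ) = p := by
  rw [Nat.card_zpowers, D.orderσ]

theorem inertia_eq (P : Ideal O) [hP : P.IsPrime] (h : α ∈ P) :
    P.inertia G = Subgroup.zpowers σ := by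
  have hNP := (D.α_mem_iff P).1 h
  have h1 := le_card_inertia (G := G) P N D.hN hNP p (by
    rw [← D.hα, ← Ideal.span_singleton_pow]
    exact pow_dvd_pow_of_dvd ((Ideal.dvd_span_singleton).2 h) p)
  apply Subgroup.eq_of_le_of_card_ge
  · exact (Ideal.inertia_le_stabilizer (M := G) P).trans (D.stab_le P h)
  · rw [D.card_zpowers]; exact h1

theorem stab_eq (P : Ideal O) [hP : P.IsPrime] (h : α ∈ P) :
    MulAction.stabilizer G P = Subgroup.zpowers σ := by
  apply le_antisymm (D.stab_le P h)
  rw [← D.inertia_eq P h]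
  exact Ideal.inertia_le_stabilizer (M := G) P

theorem σ_inertia (P : Ideal O) [hP : P.IsPrime] (h : α ∈ P) (x : O) : σ • x - x ∈ P := by
  have : σ ∈ P.inertia G := by rw [D.inertia_eq P h]; exact Subgroup.mem_zpowers σ
  exact AddSubgroup.mem_inertia.1 this x

theorem σ_stab (P : Ideal O) [hP : P.IsPrime] (h : α ∈ P) : σ • P = P := by
  have : σ ∈ MulAction.stabilizer G P := by rw [D.stab_eq P h]; exact Subgroup.mem_zpowers σ
  exact this

theorem int_mod (P : Ideal O) [hP : P.IsPrime] (h : α ∈ P) (x : O) : ∃ a : ℤ, x - a ∈ P := by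
  apply int_mod_of_stab (G := G) P N D.hN ((D.α_mem_iff P).1 h)
  rw [D.stab_eq P h, D.inertia_eq P h]

theorem sqfree_α : Squarefree (Ideal.span {α}) := by
  refine sqfree_of _ (by simp [D.α0]) ?_
  intro P hP hPb hd
  have hαP : α ∈ P := by
    rw [← Ideal.span_singleton_le_iff_mem, ← Ideal.dvd_iff_le]
    exact (dvd_pow_self P two_ne_zero).trans hd
  have h1 := le_card_inertia (G := G) P N D.hN ((D.α_mem_iff P).1 hαP) (2 * p) (by
    rw [← D.hα, ← Ideal.span_singleton_pow, pow_mul]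
    exact pow_dvd_pow_of_dvd hd p)
  rw [D.inertia_eq P hαP, D.card_zpowers] at h1
  have := D.hp.pos
  omega

theorem exists_q : ∃ q : Ideal O, q.IsPrime ∧ q ≠ ⊥ ∧ α ∈ q := by
  have hnu : Ideal.span {α} ≠ ⊤ := by
    intro h
    rw [Ideal.span_singleton_eq_top] at h
    have h1 := h.pow p
    rw [D.hα] at h1
    have h2 : Ideal.span {(N : O)} = ⊤ := Ideal.span_singleton_eq_top.2 h1
    have h3 := prime_span N D.hN
    have h4 : (Ideal.span {(N : ℤ)}).map (algebraMap ℤ O) = Ideal.span {(N : O)} := by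
      rw [Ideal.map_span]; simp
    obtain ⟨P, hP1, hP2⟩ := (inferInstance : Nonempty (Ideal.primesOver (Ideal.span {(N : ℤ)}) O))
    have h5 : (N : O) ∈ P := by
      have h6 : (N : ℤ) ∈ P.under ℤ := by
        rw [← hP2.over]; exact Ideal.mem_span_singleton_self _
      simpa using h6
    exact hP1.ne_top (P.eq_top_of_isUnit_mem h5 h1)
  obtain ⟨q, hq, hle⟩ := Ideal.exists_le_maximal _ hnu
  have hm : α ∈ q := hle (Ideal.mem_span_singleton_self α)
  refine ⟨q, hq.isPrime, ?_, hm⟩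
  rintro rfl
  exact D.α0 (by simpa using hm)

theorem δα_mem (q : Ideal O) (h : α ∈ q) (i : ℕ) : α ∈ δ ^ i • q := by
  rw [← D.δpow_α i]; exact (mem_smul_iff _ _ _).2 h

theorem over_N (q Q : Ideal O) [hq : q.IsPrime] [hQ : Q.IsPrime] (h : α ∈ q) (h' : α ∈ Q) :
    ∃ i < p - 1, Q = δ ^ i • q := by
  obtain ⟨τ, hτ⟩ := exists_smul_eq (G := G) q Q N D.hN ((D.α_mem_iff q).1 h) ((D.α_mem_iff Q).1 h')
  obtain ⟨i, hi, k, hk, rfl⟩ := D.τ_eq τ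
  refine ⟨i, hi, ?_⟩
  have h1 : σ ^ k • q = q := by
    have : σ ^ k ∈ MulAction.stabilizer G q := by
      rw [D.stab_eq q h]; exact Subgroup.npow_mem_zpowers σ k
    exact this
  rw [← hτ, mul_smul, h1]

theorem δq_inj (q : Ideal O) [hq : q.IsPrime] (h : α ∈ q) (i j : ℕ) (hi : i < p - 1)
    (hj : j < p - 1) (hij : δ ^ i • q = δ ^ j • q) : i = j := by
  apply D.δζ_inj i j hi hj
  have h1 := D.stab_ζ q h ((δ ^ j)⁻¹ * δ ^ i) (by rw [mul_smul, hij, inv_smul_smul])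
  rw [mul_smul, inv_smul_eq_iff] at h1
  exact h1

theorem prod_δq (q : Ideal O) [hq : q.IsPrime] (h : α ∈ q) :
    ∏ i ∈ Finset.range (p - 1), δ ^ i • q = Ideal.span {α} := by
  have hq0 : q ≠ ⊥ := by rintro rfl; exact D.α0 (by simpa using h)
  have hpr : ∀ i : ℕ, Prime (δ ^ i • q) := fun i =>
    Ideal.prime_of_isPrime (smul_ne_bot _ _ hq0) inferInstance
  apply associated_iff_eq.1
  apply associated_of_dvd_dvd
  · classical
    have h2 : ∏ i ∈ Finset.range (p - 1), δ ^ i • q =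
        ∏ P ∈ (Finset.range (p - 1)).image (fun i => δ ^ i • q), P := by
      rw [Finset.prod_image]
      intro i hi j hj hij
      exact D.δq_inj q h i j (by simpa using hi) (by simpa using hj) hij
    rw [h2]
    apply Finset.prod_primes_dvd
    · intro P hP
      obtain ⟨i, -, rfl⟩ := Finset.mem_image.1 hP
      exact hpr i
    · intro P hP
      obtain ⟨i, -, rfl⟩ := Finset.mem_image.1 hP
      exact Ideal.dvd_span_singleton.2 (D.δα_mem q h i)
  · apply dvd_of_sqfree _ _ D.sqfree_α (Finset.prod_ne_zero_iff.2 fun i _ => (hpr i).ne_zero)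
    intro P hP hd
    rw [Ideal.dvd_span_singleton] at hd
    obtain ⟨i, hi, rfl⟩ := D.over_N q P h hd
    exact Finset.dvd_prod_of_mem _ (Finset.mem_range.2 hi)

theorem exists_x (hp2 : p ^ 2 ∣ N - 1) : ∃ x : O, (1 - ζ) * x = α - 1 := by
  obtain ⟨c, hc⟩ := D.πpow_dvd
  obtain ⟨r, hr⟩ := exists_add_pow_prime_eq D.hp (1 : O) (α - 1)
  have hr' : (N : O) = 1 + (α - 1) ^ p + p * (α - 1) * r := by
    rw [← D.hα]
    have : (1 + (α - 1)) = α := by ring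
    rw [this] at hr
    rw [hr]; ring
  have hB : ∃ b : O, (1 : O) - N = (1 - ζ) ^ p * b := by
    obtain ⟨m, hm⟩ := hp2
    have hN1 : (N : O) - 1 = (p : O) ^ 2 * m := by
      have := congrArg (Nat.cast : ℕ → O) hm
      rw [Nat.cast_sub D.hN.one_le] at this
      push_cast at this
      exact this
    have h2 : (1 - ζ) ^ p ∣ (p : O) ^ 2 := by
      rw [hc, mul_pow, ← pow_mul]
      exact Dvd.dvd.mul_right (pow_dvd_pow _ (by have := D.hp2; omega)) _
    obtain ⟨d, hd⟩ := h2
    exact ⟨-(d * m), by rw [← neg_sub, hN1, hd]; ring⟩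
  obtain ⟨b, hb⟩ := hB
  let F := FractionRing O
  let f := algebraMap O F
  have hf : Function.Injective f := IsFractionRing.injective O F
  have hπ : f (1 - ζ) ≠ 0 := fun h => D.π_ne (hf (by rw [h, map_zero]))
  let x : F := f (α - 1) / f (1 - ζ)
  have hx : f (1 - ζ) * x = f (α - 1) := by
    simp only [x]; rw [← mul_div_assoc, mul_div_cancel_left₀ _ hπ]
  have hxint : IsIntegral O x := by
    refine ⟨Polynomial.X ^ p + (Polynomial.C (c * r) * Polynomial.X + Polynomial.C b), ?_, ?_⟩
    · apply Polynomial.monic_X_pow_add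
      refine lt_of_le_of_lt Polynomial.degree_linear_le ?_
      exact_mod_cast (by have := D.hp2; omega)
    · have hp1 : p = (p - 1) + 1 := (Nat.sub_add_cancel D.hp.one_le).symm
      rw [Polynomial.eval₂_add, Polynomial.eval₂_add, Polynomial.eval₂_mul, Polynomial.eval₂_pow,
        Polynomial.eval₂_X, Polynomial.eval₂_C, Polynomial.eval₂_C]
      apply mul_left_cancel₀ (pow_ne_zero p hπ)
      change f (1 - ζ) ^ p * (x ^ p + (f (c * r) * x + f b)) = _
      have e1 : f (1 - ζ) ^ p * x ^ p = f ((α - 1) ^ p) := by rw [← mul_pow, hx, map_pow]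
      have e2 : f (1 - ζ) ^ p * (f (c * r) * x) = f (p * (α - 1) * r) := by
        conv_lhs => rw [hp1, pow_succ]
        rw [map_mul f c r, map_mul, map_mul, hc, map_mul, map_pow, ← hx]; ring
      have e3 : f (1 - ζ) ^ p * f b = f (1 - N) := by rw [hb, map_mul, map_pow]
      rw [mul_add, mul_add, e1, e2, e3, ← map_add, ← map_add, mul_zero, ← map_zero f]
      congr 1
      rw [hr']; ring
  obtain ⟨y, hy⟩ := IsIntegrallyClosed.isIntegral_iff.1 hxint
  refine ⟨y, hf ?_⟩
  rw [map_mul, ← hx, ← hy]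

theorem sqfree_π (hp2 : p ^ 2 ∣ N - 1) : Squarefree (Ideal.span {1 - ζ}) := by
  refine sqfree_of _ (by simpa using D.π_ne) ?_
  intro P hP hPb hd
  have hπP : 1 - ζ ∈ P := by
    rw [← Ideal.span_singleton_le_iff_mem, ← Ideal.dvd_iff_le]
    exact (dvd_pow_self P two_ne_zero).trans hd
  have hpP := (D.p_mem_iff P).2 hπP
  have hαP : α ∉ P := fun h => D.p_not_mem P h hpP
  have h1 := le_card_inertia (G := G) P p D.hp hpP (2 * (p - 1)) (by
    rw [pow_mul]
    refine (pow_dvd_pow_of_dvd hd (p - 1)).trans ?_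
    rw [Ideal.span_singleton_pow, Ideal.dvd_span_singleton, Ideal.mem_span_singleton]
    exact D.πpow_dvd)
  obtain ⟨x, hx⟩ := D.exists_x hp2
  have hσ : σ ∉ P.inertia G := by
    intro h
    have h2 : σ • x - x ∈ P := AddSubgroup.mem_inertia.1 h x
    have h3 : σ • x - x = -α := by
      apply mul_left_cancel₀ D.π_ne
      have h4 := congrArg (σ • ·) hx
      simp only [smul_mul', smul_sub, smul_one, D.σζ, D.σα] at h4
      rw [mul_sub, h4, hx]; ring
    rw [h3] at h2
    exact hαP (by simpa using h2)
  have hσk : ∀ k < p, σ ^ k ∈ P.inertia G → k = 0 := by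
    intro k hk h
    by_contra hk0
    apply hσ
    have hcop : Nat.Coprime k (orderOf σ) := by
      rw [D.orderσ]
      exact (Nat.Coprime.symm ((Nat.Prime.coprime_iff_not_dvd D.hp).2 (Nat.not_dvd_of_pos_of_lt (Nat.pos_of_ne_zero hk0) hk)))
    obtain ⟨m, hm⟩ := exists_pow_eq_self_of_coprime hcop
    rw [← hm]
    exact Subgroup.pow_mem _ h m
  -- injection
  choose i hi hi' using D.τζ
  let φ : P.inertia G → Fin (p - 1) := fun τ => ⟨i τ, hi τ⟩
  have hφ : Function.Injective φ := by
    intro τ τ' h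
    have h2 : i τ = i τ' := congrArg Fin.val h
    have h3 : ((τ' : G)⁻¹ * (τ : G)) • ζ = ζ := by
      rw [mul_smul, hi' τ, h2, ← hi' τ', inv_smul_smul]
    obtain ⟨k, hk, h4⟩ := D.mem_σ _ h3
    have h5 : (τ' : G)⁻¹ * (τ : G) ∈ P.inertia G :=
      Subgroup.mul_mem _ (Subgroup.inv_mem _ τ'.2) τ.2
    rw [h4] at h5
    rw [hσk k hk h5, pow_zero, inv_mul_eq_one] at h4
    exact Subtype.ext h4.symm
  have h6 := Nat.card_le_card_of_injective φ hφ
  rw [Nat.card_fin] at h6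
  have := D.hp2
  omega

theorem π_inv (τ : G) : τ • Ideal.span {1 - ζ} = Ideal.span {1 - ζ} := by
  apply inv_of_le
  intro τ
  obtain ⟨k, hk⟩ := D.τζ' τ
  rw [smul_span, Ideal.span_singleton_le_span_singleton, smul_sub, smul_one, hk]
  exact D.π_dvd k

theorem α_inv (τ : G) : τ • Ideal.span {α} = Ideal.span {α} := by
  apply inv_of_le
  intro τ
  obtain ⟨k, -, hk⟩ := D.τα τ
  rw [smul_span, Ideal.span_singleton_le_span_singleton, hk]
  exact Dvd.intro_left _ rfl

/-- Invariant ideals are principal times powers of `R`. -/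
theorem inv_ideal (R : Ideal O) (hRs : Squarefree R) (hRi : ∀ τ : G, τ • R = R)
    (hRp : ∀ P : Ideal O, P.IsPrime → (P ∣ R ↔ (p : O) ∈ P)) (n : ℕ) (J : Ideal O)
    (hn : Ideal.absNorm J ≤ n) (hJ0 : J ≠ ⊥) (hJ : ∀ τ : G, τ • J = J) :
    ∃ (k : ℕ) (a : O), a ≠ 0 ∧ J = Ideal.span {a} * R ^ k := by
  induction n using Nat.strong_induction_on generalizing J with
  | _ n ih =>
  by_cases hJt : J = ⊤
  · exact ⟨0, 1, one_ne_zero, by simp [hJt]⟩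
  obtain ⟨P, hPm, hle⟩ := Ideal.exists_le_maximal _ hJt
  have hP := hPm.isPrime
  have hPb : P ≠ ⊥ := by rintro rfl; exact hJ0 (le_bot_iff.1 hle)
  obtain ⟨l, hl, hlP⟩ := exists_prime_nat_mem P hPb
  -- every prime over l contains J
  have hconj : ∀ Q : Ideal O, Q.IsPrime → (l : O) ∈ Q → Q ∣ J := by
    intro Q hQ hlQ
    obtain ⟨τ, rfl⟩ := exists_smul_eq (G := G) P Q l hl hlP hlQ
    rw [← hJ τ, smul_dvd, Ideal.dvd_iff_le]; exact hle
  -- general step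
  have step : ∀ I : Ideal O, Squarefree I → (∀ τ : G, τ • I = I) → I ≠ ⊤ →
      (∀ Q : Ideal O, Q.IsPrime → Q ∣ I → (l : O) ∈ Q) →
      ∃ J' : Ideal O, J = I * J' ∧
        ∃ (k : ℕ) (a : O), a ≠ 0 ∧ J' = Ideal.span {a} * R ^ k := by
    intro I hI hIi hIt hIl
    have hI0 : I ≠ ⊥ := hI.ne_zero
    obtain ⟨J', hJ'⟩ := dvd_of_sqfree I J hI hJ0 (fun Q hQ hd => hconj Q hQ (hIl Q hQ hd))
    have hJ'0 : J' ≠ ⊥ := by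
      rintro rfl; apply hJ0; rw [hJ']; simp
    refine ⟨J', hJ', ih (Ideal.absNorm J') ?_ J' le_rfl hJ'0 ?_⟩
    · rw [hJ', map_mul] at hn
      have h1 : Ideal.absNorm I ≠ 1 := fun h => hIt (Ideal.absNorm_eq_one_iff.1 h)
      have h2 : Ideal.absNorm I ≠ 0 := Ideal.absNorm_eq_zero_iff.not.2 hI0
      have h3 : Ideal.absNorm J' ≠ 0 := Ideal.absNorm_eq_zero_iff.not.2 hJ'0
      have h4 : 2 ≤ Ideal.absNorm I := by omega
      have h5 : 1 ≤ Ideal.absNorm J' := by omega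
      nlinarith
    · intro τ
      have h1 := hJ τ
      rw [hJ', smul_mul', hIi] at h1
      exact mul_left_cancel₀ hI0 h1
  by_cases hlp : l = p
  · subst hlp
    obtain ⟨J', hJ', k, a, ha, h⟩ := step R hRs hRi
      (by rintro h; have := (hRp P hP).2 hlP; rw [h, Ideal.dvd_iff_le, top_le_iff] at this
          exact hP.ne_top this)
      (fun Q hQ hd => (hRp Q hQ).1 hd)
    exact ⟨k + 1, a, ha, by rw [hJ', h]; ring⟩
  have hprinc : ∀ b : O, b ≠ 0 → (∃ J' : Ideal O, J = Ideal.span {b} * J' ∧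
        ∃ (k : ℕ) (a : O), a ≠ 0 ∧ J' = Ideal.span {a} * R ^ k) →
      ∃ (k : ℕ) (a : O), a ≠ 0 ∧ J = Ideal.span {a} * R ^ k := by
    rintro b hb ⟨J', hJ', k, a, ha, h⟩
    exact ⟨k, b * a, mul_ne_zero hb ha, by
      rw [hJ', h, ← Ideal.span_singleton_mul_span_singleton]; ring⟩
  by_cases hlN : l = N
  · apply hprinc α D.α0
    apply step _ D.sqfree_α D.α_inv
    · intro h
      apply hP.ne_top
      rw [eq_top_iff, ← h, Ideal.span_singleton_le_iff_mem, D.α_mem_iff, ← hlN]; exact hlP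
    · intro Q hQ hd
      rw [Ideal.dvd_span_singleton, D.α_mem_iff, ← hlN] at hd
      exact hd
  · apply hprinc (l : O) (by exact_mod_cast hl.ne_zero)
    apply step _ (D.sqfree_l l hl hlp hlN)
    · intro τ; rw [smul_span, smul_natCast']
    · intro h
      apply hP.ne_top
      rw [eq_top_iff, ← h, Ideal.span_singleton_le_iff_mem]; exact hlP
    · intro Q hQ hd
      rwa [Ideal.dvd_span_singleton] at hd

end
end KData
end Kum

end

section
open Module
open scoped Pointwise

namespace Kum

section norm
variable {G M : Type*} [Group G] [CommMonoid M] [MulDistribMulAction G M]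

/-- The norm element of a cyclic group of order `p`. -/
def Nm (p : ℕ) (σ : G) (x : M) : M := ∏ i ∈ Finset.range p, σ ^ i • x

theorem Nm_mul (p : ℕ) (σ : G) (x y : M) : Nm p σ (x * y) = Nm p σ x * Nm p σ y := by
  simp [Nm, Finset.prod_mul_distrib]

theorem Nm_one (p : ℕ) (σ : G) : Nm p σ (1 : M) = 1 := by simp [Nm]

theorem Nm_pow (p : ℕ) (σ : G) (x : M) (k : ℕ) : Nm p σ (x ^ k) = Nm p σ x ^ k := by
  simp [Nm, Finset.prod_pow]

theorem Nm_smul' (p : ℕ) (σ : G) (hσ : σ ^ p = 1) (x : M) : Nm p σ (σ • x) = Nm p σ x := by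
  unfold Nm
  have h1 := Finset.prod_range_succ (fun i => σ ^ i • x) p
  have h2 := Finset.prod_range_succ' (fun i => σ ^ i • x) p
  cases p with
  | zero => simp
  | succ n =>
    rw [Finset.prod_range_succ, Finset.prod_range_succ']
    have : σ ^ n • σ • x = σ ^ 0 • x := by
      rw [← mul_smul, ← pow_succ, hσ, pow_zero]
    rw [this]
    congr 1
    apply Finset.prod_congr rfl
    intro i _
    rw [← mul_smul, ← pow_succ]

theorem smul_Nm (p : ℕ) (σ : G) (x : M) : σ • Nm p σ x = Nm p σ (σ • x) := by
  unfold Nm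
  rw [Finset.smul_prod']
  apply Finset.prod_congr rfl
  intro i _
  rw [← mul_smul, ← mul_smul, ← pow_succ, ← pow_succ']

theorem Nm_κ (p : ℕ) (σ κ : G) (hσ : σ ^ p = 1) (h : κ * σ = σ ^ (p - 1) * κ) (x : M) :
    Nm p σ (κ • x) = κ • Nm p σ x := by
  have h0 : ∀ i ≤ p, κ * σ ^ i = σ ^ (p - i) * κ := by
    intro i
    induction i with
    | zero => intro _; simp [hσ]
    | succ i ih =>
      intro hi
      rw [pow_succ, ← mul_assoc, ih (by omega), mul_assoc, h, ← mul_assoc, ← pow_add]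
      have : p - i + (p - 1) = (p - (i + 1)) + p := by omega
      rw [this, pow_add, hσ, mul_one]
  rw [← Nm_smul' p σ hσ (κ • x)]
  unfold Nm
  rw [Finset.smul_prod', ← Finset.prod_range_reflect]
  apply Finset.prod_congr rfl
  intro i hi
  have hi := Finset.mem_range.1 hi
  rw [← mul_smul, ← mul_smul, ← mul_smul, h0 i hi.le, ← pow_succ]
  congr 3
  omega
end norm

section cl
variable {O : Type*} [CommRing O] [IsDomain O] [IsDedekindDomain O]

open Classical in
/-- class of an ideal (junk `1` at `⊥`) -/
noncomputable def cl (I : Ideal O) : ClassGroup O :=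
  if h : I ≠ ⊥ then ClassGroup.mk0 ⟨I, mem_nonZeroDivisors_of_ne_zero h⟩ else 1

theorem cl_eq (I : Ideal O) (h : I ≠ ⊥) :
    cl I = ClassGroup.mk0 ⟨I, mem_nonZeroDivisors_of_ne_zero h⟩ := dif_pos h

theorem cl_mul (I J : Ideal O) (hI : I ≠ ⊥) (hJ : J ≠ ⊥) : cl (I * J) = cl I * cl J := by
  rw [cl_eq I hI, cl_eq J hJ, cl_eq _ (mul_ne_zero hI hJ), ← map_mul]; rfl

theorem cl_pow (I : Ideal O) (hI : I ≠ ⊥) (k : ℕ) : cl (I ^ k) = cl I ^ k := by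
  rw [cl_eq I hI, cl_eq _ (pow_ne_zero k hI), ← map_pow]; rfl

theorem cl_prod {ι : Type*} (s : Finset ι) (f : ι → Ideal O) (h : ∀ i, f i ≠ ⊥) :
    cl (∏ i ∈ s, f i) = ∏ i ∈ s, cl (f i) := by
  classical
  induction s using Finset.induction_on with
  | empty =>
    simp only [Finset.prod_empty]
    rw [cl_eq _ one_ne_zero]; exact map_one _
  | insert a s ha ih =>
    rw [Finset.prod_insert ha, Finset.prod_insert ha, cl_mul _ _ (h a), ih]
    exact Finset.prod_ne_zero_iff.2 fun i _ => h i

theorem exists_cl (c : ClassGroup O) : ∃ I : Ideal O, I ≠ ⊥ ∧ cl I = c := by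
  obtain ⟨I, rfl⟩ := ClassGroup.mk0_surjective c
  have hI : (I : Ideal O) ≠ ⊥ := nonZeroDivisors.ne_zero I.2
  exact ⟨I, hI, cl_eq _ hI⟩

theorem cl_eq_iff (I J : Ideal O) (hI : I ≠ ⊥) (hJ : J ≠ ⊥) :
    cl I = cl J ↔ ∃ x y : O, x ≠ 0 ∧ y ≠ 0 ∧ Ideal.span {x} * I = Ideal.span {y} * J := by
  rw [cl_eq I hI, cl_eq J hJ, ClassGroup.mk0_eq_mk0_iff]
  constructor
  · rintro ⟨x, y, hx, hy, h⟩; exact ⟨x, y, hx, hy, h⟩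
  · rintro ⟨x, y, hx, hy, h⟩; exact ⟨x, y, hx, hy, h⟩

theorem cl_eq_one_iff (I : Ideal O) (hI : I ≠ ⊥) :
    cl I = 1 ↔ ∃ x : O, I = Ideal.span {x} := by
  rw [cl_eq I hI, ClassGroup.mk0_eq_one_iff, Submodule.isPrincipal_iff]

theorem cl_span (x : O) (hx : x ≠ 0) : cl (Ideal.span {x}) = 1 :=
  (cl_eq_one_iff _ (by simpa using hx)).2 ⟨x, rfl⟩

theorem cl_span_mul (x : O) (hx : x ≠ 0) (I : Ideal O) (hI : I ≠ ⊥) :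
    cl (Ideal.span {x} * I) = cl I := by
  rw [cl_mul _ _ (by simpa using hx) hI, cl_span x hx, one_mul]

variable {G : Type*} [Group G] [MulSemiringAction G O]

theorem smul_ne_bot' (τ : G) (I : Ideal O) (h : I ≠ ⊥) : τ • I ≠ ⊥ := by
  intro h1; apply h
  have : τ⁻¹ • τ • I = ⊥ := by rw [h1, Ideal.smul_bot]
  simpa using this

theorem smul_span' (τ : G) (x : O) : τ • Ideal.span {x} = Ideal.span {τ • x} := by
  rw [Ideal.smul_closure]; simp

theorem smul_ne0 (τ : G) (x : O) (h : x ≠ 0) : τ • x ≠ 0 := (smul_ne_zero_iff_ne τ).2 h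

theorem cl_smul_congr (τ : G) (I J : Ideal O) (hI : I ≠ ⊥) (hJ : J ≠ ⊥) (h : cl I = cl J) :
    cl (τ • I) = cl (τ • J) := by
  obtain ⟨x, y, hx, hy, h⟩ := (cl_eq_iff I J hI hJ).1 h
  refine (cl_eq_iff _ _ (smul_ne_bot' τ I hI) (smul_ne_bot' τ J hJ)).2
    ⟨τ • x, τ • y, smul_ne0 τ x hx, smul_ne0 τ y hy, ?_⟩
  rw [← smul_span', ← smul_span', ← smul_mul', ← smul_mul', h]

/-- action on the class group -/
noncomputable def act (τ : G) : ClassGroup O →* ClassGroup O where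
  toFun c := cl (τ • (exists_cl c).choose)
  map_one' := by
    have h := (exists_cl (1 : ClassGroup O)).choose_spec
    rw [cl_smul_congr τ _ (Ideal.span {1}) h.1 (by simp) (by rw [h.2, cl_span 1 one_ne_zero]),
      smul_span', smul_one, cl_span 1 one_ne_zero]
  map_mul' a b := by
    have h := (exists_cl (a * b)).choose_spec
    have ha := (exists_cl a).choose_spec
    have hb := (exists_cl b).choose_spec
    rw [← cl_mul _ _ (smul_ne_bot' τ _ ha.1) (smul_ne_bot' τ _ hb.1), ← smul_mul']
    apply cl_smul_congr τ _ _ h.1 (mul_ne_zero ha.1 hb.1)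
    rw [cl_mul _ _ ha.1 hb.1, ha.2, hb.2, h.2]

theorem act_cl (τ : G) (I : Ideal O) (hI : I ≠ ⊥) : act τ (cl I) = cl (τ • I) := by
  have h := (exists_cl (cl I)).choose_spec
  exact cl_smul_congr τ _ _ h.1 hI h.2

theorem act_mul (τ τ' : G) (c : ClassGroup O) : act (τ * τ') c = act τ (act τ' c) := by
  obtain ⟨I, hI, rfl⟩ := exists_cl c
  rw [act_cl _ _ hI, act_cl _ _ hI, act_cl _ _ (smul_ne_bot' _ _ hI), mul_smul]

theorem act_one (c : ClassGroup O) : act (1 : G) c = c := by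
  obtain ⟨I, hI, rfl⟩ := exists_cl c
  rw [act_cl _ _ hI, one_smul]

theorem act_pow_fix (τ : G) (c : ClassGroup O) (h : act τ c = c) (i : ℕ) : act (τ ^ i) c = c := by
  induction i with
  | zero => rw [pow_zero, act_one]
  | succ i ih => rw [pow_succ, act_mul, h, ih]

/-- local cancellation -/
theorem loc_frac (q I J : Ideal O) [hq : q.IsPrime] (hI : ¬ I ≤ q) (hJ : ¬ J ≤ q) (x y : O)
    (hx : x ≠ 0) (hxy : Ideal.span {y} * J = Ideal.span {x} * I) :
    ∃ s t : O, s ∉ q ∧ t ∉ q ∧ t * x = s * y := by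
  obtain ⟨t, ht, htq⟩ := SetLike.not_le_iff_exists.1 hI
  obtain ⟨s', hs', hsq'⟩ := SetLike.not_le_iff_exists.1 hJ
  have h1 : x * t ∈ Ideal.span {y} * J := by
    rw [hxy]; exact Ideal.mul_mem_mul (Ideal.mem_span_singleton_self x) ht
  have h2 : y * s' ∈ Ideal.span {x} * I := by
    rw [← hxy]; exact Ideal.mul_mem_mul (Ideal.mem_span_singleton_self y) hs'
  obtain ⟨s, hs, h1⟩ := Ideal.mem_span_singleton_mul.1 h1
  obtain ⟨t', ht', h2⟩ := Ideal.mem_span_singleton_mul.1 h2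
  refine ⟨s, t, ?_, htq, by rw [mul_comm t, ← h1, mul_comm]⟩
  intro hsq
  have h3 : t * s' = s * t' := by
    apply mul_left_cancel₀ hx
    calc x * (t * s') = (x * t) * s' := by ring
      _ = s * (y * s') := by rw [← h1]; ring
      _ = x * (s * t') := by rw [← h2]; ring
  rcases hq.mem_or_mem (h3 ▸ q.mul_mem_right t' hsq : t * s' ∈ q) with h | h
  · exact htq h
  · exact hsq' h

theorem split_q (q I : Ideal O) [hq : q.IsPrime] (hq0 : q ≠ ⊥) (hI : I ≠ ⊥) :
    ∃ (m : ℕ) (J : Ideal O), I = q ^ m * J ∧ ¬ J ≤ q := by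
  have hpr : Prime q := Ideal.prime_of_isPrime hq0 hq
  have hfin : FiniteMultiplicity q I := FiniteMultiplicity.of_prime_left hpr hI
  obtain ⟨J, h1, h2⟩ := hfin.exists_eq_pow_mul_and_not_dvd
  exact ⟨_, J, h1, by rwa [← Ideal.dvd_iff_le]⟩
end cl
end Kum

end

section
open Module
open scoped Pointwise

namespace Kum
namespace KData
variable {O G : Type*} [CommRing O] [IsDomain O] [IsDedekindDomain O] [CharZero O]
  [Module.Free ℤ O] [Module.Finite ℤ O]
  [Group G] [Finite G] [MulSemiringAction G O] [IsGaloisGroup G ℤ O]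
  {p N : ℕ} {u : (ZMod p)ˣ} {ζ α : O} {σ δ : G} 

section
variable (D : KData p N u ζ α σ δ)
include D

theorem Nm_ne0 (x : O) (hx : x ≠ 0) : Nm p σ x ≠ 0 :=
  Finset.prod_ne_zero_iff.2 fun i _ => smul_ne0 _ _ hx

theorem Nm_neb (I : Ideal O) (hI : I ≠ ⊥) : Nm p σ I ≠ ⊥ :=
  Finset.prod_ne_zero_iff.2 fun i _ => smul_ne_bot _ _ hI

theorem Nm_span (x : O) : Nm p σ (Ideal.span {x}) = Ideal.span {Nm p σ x} := by
  unfold Nm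
  rw [← Ideal.prod_span_singleton]
  exact Finset.prod_congr rfl fun i _ => smul_span _ _

theorem Nm_assoc (I : Ideal O) (hI : I ≠ ⊥) (x y : O) 
    (h : Ideal.span {y} * (σ • I) = Ideal.span {x} * I) :
    ∃ ε : Oˣ, Nm p σ x = ε * Nm p σ y := by
  have h1 := congrArg (Nm p σ) h
  rw [Nm_mul, Nm_mul, Nm_smul' p σ D.σp, D.Nm_span, D.Nm_span] at h1
  have h2 := mul_right_cancel₀ (D.Nm_neb I hI) h1
  obtain ⟨e, he⟩ := Ideal.span_singleton_eq_span_singleton.1 h2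
  exact ⟨e, by rw [← he, mul_comm]⟩

theorem Nm_fix (x : O) : σ • Nm p σ x = Nm p σ x := by
  rw [smul_Nm, Nm_smul' p σ D.σp]

theorem claimA (κ : G) (hκ : κ * σ = σ ^ (p - 1) * κ)
    (hunit : ∀ ε η : Oˣ, σ • (ε : O) = ε → (ε : O) * κ • (ε : O) = Nm p σ (η : O) →
      ∃ (j : ℕ) (v : Oˣ), (ε : O) = ζ ^ j * Nm p σ (v : O))
    (c : ClassGroup O) (hσ : act σ c = c) (hκc : act κ c = c) :
    ∃ (I : Ideal O) (x y : O) (j : ℕ), I ≠ ⊥ ∧ cl I = c ∧ x ≠ 0 ∧ y ≠ 0 ∧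
      Ideal.span {y} * (σ • I) = Ideal.span {x} * I ∧ Nm p σ x = ζ ^ j * Nm p σ y := by
  obtain ⟨I, hI, rfl⟩ := exists_cl c
  rw [act_cl _ _ hI, cl_eq_iff _ _ (smul_ne_bot _ _ hI) hI] at hσ hκc
  obtain ⟨y, x, hy, hx, h⟩ := hσ
  obtain ⟨a, b, ha, hb, h'⟩ := hκc
  obtain ⟨ε, hε⟩ := D.Nm_assoc I hI x y h
  have hfix : σ • (ε : O) = ε := by
    have h1 := congrArg (σ • ·) hε
    simp only [smul_mul', D.Nm_fix] at h1
    rw [hε] at h1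
    exact (mul_right_cancel₀ (D.Nm_ne0 y hy) h1).symm
  -- X, Y
  set X := σ • κ • x with hX
  set Y := σ • κ • y with hY
  have hXY : Ideal.span {Y} * (κ • I) = Ideal.span {X} * (σ • κ • I) := by
    have h1 := congrArg (fun J => (σ * κ) • J) h
    simp only [smul_mul', smul_span] at h1
    have h2 : (σ * κ) • σ • I = κ • I := by
      rw [← mul_smul, mul_assoc, hκ, ← mul_assoc, ← pow_succ', Nat.sub_add_cancel D.hp.one_le,
        D.σp, one_mul]
    rw [h2] at h1
    rw [mul_smul, mul_smul, mul_smul] at h1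
    exact h1
  have hab : Ideal.span {σ • a} * (σ • κ • I) = Ideal.span {σ • b} * (σ • I) := by
    have h1 := congrArg (fun J => σ • J) h'
    simp only [smul_mul', smul_span] at h1
    exact h1
  have hfin : Ideal.span {y * (σ • a) * Y * b} = Ideal.span {X * (σ • b) * x * a} := by
    apply mul_right_cancel₀ hI
    simp only [← Ideal.span_singleton_mul_span_singleton]
    calc Ideal.span {y} * Ideal.span {σ • a} * Ideal.span {Y} * Ideal.span {b} * I
        = Ideal.span {y} * Ideal.span {σ • a} * Ideal.span {Y} * (Ideal.span {b} * I) := by ring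
      _ = Ideal.span {y} * Ideal.span {σ • a} * Ideal.span {a} * (Ideal.span {Y} * (κ • I)) := by
        rw [← h']; ring
      _ = Ideal.span {y} * Ideal.span {a} * Ideal.span {X} * (Ideal.span {σ • a} * (σ • κ • I)) := by
        rw [hXY]; ring
      _ = Ideal.span {a} * Ideal.span {X} * Ideal.span {σ • b} * (Ideal.span {y} * (σ • I)) := by
        rw [hab]; ring
      _ = _ := by rw [h]; ring
  obtain ⟨η, hη⟩ := Ideal.span_singleton_eq_span_singleton.1 hfin
  have hη' := congrArg (Nm p σ) hη
  simp only [Nm_mul, Nm_smul' p σ D.σp, hX, hY, Nm_κ p σ κ D.σp hκ] at hη'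
  have hne := mul_ne_zero (D.Nm_ne0 a ha) (D.Nm_ne0 b hb)
  have e1 : Nm p σ y * (κ • Nm p σ y) * Nm p σ (η : O) = Nm p σ x * (κ • Nm p σ x) := by
    apply mul_right_cancel₀ hne
    linear_combination hη'
  rw [hε, smul_mul'] at e1
  have e2 : (ε : O) * κ • (ε : O) = Nm p σ (η : O) := by
    apply mul_right_cancel₀ (mul_ne_zero (D.Nm_ne0 y hy) (smul_ne0 κ _ (D.Nm_ne0 y hy)))
    linear_combination -e1
  obtain ⟨j, v, hv⟩ := hunit ε η hfix e2
  refine ⟨I, x, y * v, j, hI, rfl, hx, mul_ne_zero hy v.ne_zero, ?_, ?_⟩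
  · rw [← h, Ideal.span_singleton_mul_right_unit v.isUnit]
  · rw [hε, hv, Nm_mul]; ring

theorem claimF2 (I : Ideal O) (hI : I ≠ ⊥) (x y : O) (hx : x ≠ 0) (hy : y ≠ 0)
    (h : Ideal.span {y} * (σ • I) = Ideal.span {x} * I) (j : ℕ)
    (hj : Nm p σ x = ζ ^ j * Nm p σ y) : p ∣ j ∨ p ^ 2 ∣ N - 1 := by
  rw [or_iff_not_imp_left]
  intro hpj
  obtain ⟨q, hq, hq0, hα⟩ := D.exists_q
  obtain ⟨m, J, hIJ, hJ⟩ := split_q q I hq0 hI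
  have hσq := D.σ_stab q hα
  have hJ2 : Ideal.span {y} * (σ • J) = Ideal.span {x} * J := by
    rw [hIJ, smul_mul', smul_pow', hσq] at h
    apply mul_left_cancel₀ (pow_ne_zero m hq0 : q ^ m ≠ 0)
    calc _ = _ := by ring
      _ = _ := h
      _ = _ := by ring
  have hσJ : ¬ σ • J ≤ q := by
    rw [← hσq, Ideal.pointwise_smul_le_pointwise_smul_iff]; exact hJ
  obtain ⟨s, t, hs, ht, hst⟩ := loc_frac q J (σ • J) hJ hσJ x y hx hJ2
  have h1 := congrArg (Nm p σ) hst
  rw [Nm_mul, Nm_mul, hj] at h1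
  have h2 : Nm p σ t * ζ ^ j = Nm p σ s := by
    apply mul_right_cancel₀ (D.Nm_ne0 y hy); rw [← h1]; ring
  obtain ⟨a, ha⟩ := D.int_mod q hα t
  obtain ⟨b, hb⟩ := D.int_mod q hα s
  obtain ⟨z, hz⟩ := D.int_mod q hα ζ
  have hNq := (D.α_mem_iff q).1 hα
  rw [← Ideal.Quotient.eq] at ha hb hz
  set f := Ideal.Quotient.mk q
  have hf : ∀ i : ℕ, ∀ w : O, f (σ ^ i • w) = f w := by
    intro i w
    induction i with
    | zero => simp
    | succ i ih =>
      rw [pow_succ', mul_smul, ← ih, Ideal.Quotient.eq]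
      exact D.σ_inertia q hα _
  have hNmf : ∀ w : O, f (Nm p σ w) = f w ^ p := by
    intro w
    unfold Nm
    rw [map_prod, Finset.prod_congr rfl fun i _ => hf i w]; simp
  have h3 := congrArg f h2
  rw [map_mul, map_pow, hNmf, hNmf, ha, hb, hz] at h3
  have hcast : ∀ k : ℤ, f (k : O) = 0 ↔ (k : ZMod N) = 0 := by
    intro k
    rw [Ideal.Quotient.eq_zero_iff_mem, int_mem_iff q N D.hN hNq, ZMod.intCast_zmod_eq_zero_iff_dvd]
  have : Fact N.Prime := ⟨D.hN⟩
  have : Fact p.Prime := ⟨D.hp⟩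
  have ha0 : (a : ZMod N) ≠ 0 := by
    rw [Ne, ← hcast, ← ha, Ideal.Quotient.eq_zero_iff_mem]; exact ht
  have hb0 : (b : ZMod N) ≠ 0 := by
    rw [Ne, ← hcast, ← hb, Ideal.Quotient.eq_zero_iff_mem]; exact hs
  have h4 : (a : ZMod N) ^ p * (z : ZMod N) ^ j = (b : ZMod N) ^ p := by
    have := (hcast (a ^ p * z ^ j - b ^ p)).1 (by
      push_cast; rw [map_sub, map_mul, map_pow, map_pow, map_pow, h3, sub_self])
    push_cast at this
    exact sub_eq_zero.1 this
  have hzp : (z : ZMod N) ^ p = 1 := by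
    have := (hcast (z ^ p - 1)).1 (by
      push_cast; rw [map_sub, map_pow, ← hz, ← map_pow, D.hζ.pow_eq_one, sub_self])
    push_cast at this
    exact sub_eq_zero.1 this
  have hzj : (z : ZMod N) ^ j ≠ 1 := by
    intro h5
    have h6 := (hcast (z ^ j - 1)).2 (by push_cast; rw [h5, sub_self])
    push_cast at h6
    rw [map_sub, map_pow, ← hz, ← map_pow, ← map_sub, Ideal.Quotient.eq_zero_iff_mem] at h6
    exact D.p_not_mem q hα (D.p_mem_of q j hpj h6)
  let e : ZMod N := b / a
  have he : e ^ p = (z : ZMod N) ^ j := by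
    simp only [e]
    rw [div_pow, div_eq_iff (pow_ne_zero _ ha0), ← h4]; ring
  have hord : orderOf e = p ^ (1 + 1) := by
    apply orderOf_eq_prime_pow
    · rw [pow_one, he]; exact hzj
    · rw [pow_succ, pow_one, pow_mul, he, ← pow_mul, mul_comm, pow_mul, hzp, one_pow]
  have he0 : e ≠ 0 := div_ne_zero hb0 ha0
  have := orderOf_dvd_of_pow_eq_one (ZMod.pow_card_sub_one_eq_one he0)
  rwa [hord] at this

theorem hilbert90 (x y : O) (hx : x ≠ 0) (hy : y ≠ 0) (h : Nm p σ x = Nm p σ y) :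
    ∃ z : O, z ≠ 0 ∧ y * σ • z = x * z := by
  have hp0 : 0 < p := D.hp.pos
  let c : ℕ → O := fun i => (∏ j ∈ Finset.range i, σ ^ j • y) * ∏ j ∈ Finset.Ico i p, σ ^ j • x
  let f : ℕ → O → O := fun i w => c i * σ ^ i • w
  -- recursion
  have hrec : ∀ i < p, y * σ • c i = x * c (i + 1) := by
    intro i hi
    simp only [c, smul_mul', Finset.smul_prod']
    have e1 : y * ∏ j ∈ Finset.range i, σ • σ ^ j • y = ∏ j ∈ Finset.range (i + 1), σ ^ j • y := by
      rw [Finset.prod_range_succ']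
      simp only [pow_zero, one_smul, ← mul_smul, ← pow_succ']
      ring
    have e2 : ∏ j ∈ Finset.Ico i p, σ • σ ^ j • x = (∏ j ∈ Finset.Ico (i + 1) p, σ ^ j • x) * x := by
      simp only [← mul_smul, ← pow_succ']
      rw [Finset.prod_Ico_add' (fun j => σ ^ j • x) i p 1, Finset.prod_Ico_succ_top (by omega), D.σp,
        one_smul]
    rw [← mul_assoc, e1, e2]; ring
  have hcp : c p = c 0 := by
    simp only [c, Finset.Ico_self, Finset.prod_empty, Finset.range_zero, mul_one, one_mul]
    rw [← Finset.range_eq_Ico]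
    exact h.symm
  have hz : ∀ w : O, y * σ • (∑ i ∈ Finset.range p, c i * σ ^ i • w) =
      x * ∑ i ∈ Finset.range p, c i * σ ^ i • w := by
    intro w
    have h1 : y * σ • (∑ i ∈ Finset.range p, c i * σ ^ i • w) =
        x * ∑ i ∈ Finset.range p, c (i + 1) * σ ^ (i + 1) • w := by
      rw [Finset.smul_sum, Finset.mul_sum, Finset.mul_sum]
      apply Finset.sum_congr rfl
      intro i hi
      rw [smul_mul', ← mul_assoc, hrec i (Finset.mem_range.1 hi), ← mul_smul, ← pow_succ']; ring
    rw [h1]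
    congr 1
    have h2 := Finset.sum_range_succ (fun i => c i * σ ^ i • w) p
    have h3 := Finset.sum_range_succ' (fun i => c i * σ ^ i • w) p
    rw [h2] at h3
    rw [hcp, D.σp, pow_zero] at h3
    exact (add_right_cancel h3).symm
  suffices ∃ w : O, ∑ i ∈ Finset.range p, c i * σ ^ i • w ≠ 0 by
    obtain ⟨w, hw⟩ := this
    exact ⟨_, hw, hz w⟩
  by_contra hcon
  push Not at hcon
  let φ : Fin p → (O →* O) := fun i => (MulSemiringAction.toRingHom G O (σ ^ (i : ℕ)) : O →* O)
  have hφ : Function.Injective φ := by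
    intro i j hij
    have h1 : σ ^ (i : ℕ) • α = σ ^ (j : ℕ) • α := congrArg (fun f : O →* O => f α) hij
    rw [D.σpow_α, D.σpow_α] at h1
    exact Fin.ext (D.hζ.pow_inj i.2 j.2 (mul_right_cancel₀ D.α0 h1))
  have hli := (linearIndependent_monoidHom O O).comp φ hφ
  rw [Fintype.linearIndependent_iff] at hli
  have h0 := hli (fun i => c i) (by
    funext w
    have := hcon w
    rw [Finset.sum_range] at this
    simp only [Finset.sum_apply, Pi.smul_apply, smul_eq_mul, Pi.zero_apply]
    exact this) ⟨0, hp0⟩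
  have : c 0 ≠ 0 := by
    simp only [c, Finset.range_zero, Finset.prod_empty, one_mul]
    exact Finset.prod_ne_zero_iff.2 fun i _ => smul_ne0 _ _ hx
  exact this h0

theorem claimF3 (R : Ideal O) (hRs : Squarefree R) (hRi : ∀ τ : G, τ • R = R)
    (hRp : ∀ P : Ideal O, P.IsPrime → (P ∣ R ↔ (p : O) ∈ P))
    (I : Ideal O) (hI : I ≠ ⊥) (x y : O) (hx : x ≠ 0) (hy : y ≠ 0)
    (h : Ideal.span {y} * (σ • I) = Ideal.span {x} * I)
    (hj : Nm p σ x = Nm p σ y) (hδ : act δ (cl I) = cl I) :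
    ∃ k : ℕ, cl I ^ (p - 1) = cl R ^ k := by
  obtain ⟨z, hz0, hz⟩ := D.hilbert90 x y hx hy hj
  -- z' * z is the norm
  let z' := ∏ i ∈ Finset.range (p - 1), σ ^ (i + 1) • z
  have hz'0 : z' ≠ 0 := Finset.prod_ne_zero_iff.2 fun i _ => smul_ne0 _ _ hz0
  have hzz : z' * z = Nm p σ z := by
    unfold Nm
    have hp1 : p = (p - 1) + 1 := (Nat.sub_add_cancel D.hp.one_le).symm
    conv_rhs => rw [hp1]
    rw [Finset.prod_range_succ']
    simp [z']
  let A := Ideal.span {z'} * I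
  have hA0 : A ≠ ⊥ := mul_ne_zero (by simpa using hz'0) hI
  have hAc : cl A = cl I := cl_span_mul z' hz'0 I hI
  have hAσ : σ • A = A := by
    have e1 : Ideal.span {σ • z'} * Ideal.span {σ • z} = Ideal.span {z'} * Ideal.span {z} := by
      rw [Ideal.span_singleton_mul_span_singleton, Ideal.span_singleton_mul_span_singleton,
        ← smul_mul', hzz, D.Nm_fix]
    have e2 : Ideal.span {y} * Ideal.span {σ • z} = Ideal.span {x} * Ideal.span {z} := by
      rw [Ideal.span_singleton_mul_span_singleton, Ideal.span_singleton_mul_span_singleton, hz]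
    simp only [A]
    rw [smul_mul', smul_span]
    have hs : Ideal.span {y} * Ideal.span {σ • z} ≠ 0 :=
      mul_ne_zero (by simpa using hy) (by simpa using smul_ne0 σ z hz0)
    apply mul_left_cancel₀ hs
    calc Ideal.span {y} * Ideal.span {σ • z} * (Ideal.span {σ • z'} * σ • I)
        = (Ideal.span {σ • z'} * Ideal.span {σ • z}) * (Ideal.span {y} * (σ • I)) := by ring
      _ = Ideal.span {z'} * Ideal.span {z} * (Ideal.span {x} * I) := by rw [e1, h]
      _ = _ := by rw [e2]; ring
  have hAσk : ∀ k : ℕ, σ ^ k • A = A := by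
    intro k
    induction k with
    | zero => simp
    | succ k ih => rw [pow_succ, mul_smul, hAσ, ih]
  let J := ∏ i ∈ Finset.range (p - 1), δ ^ i • A
  have hJ0 : J ≠ ⊥ := Finset.prod_ne_zero_iff.2 fun i _ => smul_ne_bot _ _ hA0
  have hδJ : δ • J = J := by
    change δ • Nm (p - 1) δ A = Nm (p - 1) δ A
    rw [smul_Nm, Nm_smul' _ _ D.δp]
  have hδiA : ∀ i k : ℕ, σ ^ k • δ ^ i • A = δ ^ i • A := by
    intro i k
    have h1 := D.mem_σ ((δ ^ i)⁻¹ * σ ^ k * δ ^ i) (by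
      rw [mul_smul, mul_smul, D.δpow_ζ, smul_pow', D.σpow_ζ, ← D.δpow_ζ, inv_smul_smul])
    obtain ⟨m, -, hm⟩ := h1
    have h2 := hAσk m
    rw [← hm, mul_smul, mul_smul, inv_smul_eq_iff] at h2
    exact h2
  have hJ : ∀ τ : G, τ • J = J := by
    intro τ
    obtain ⟨i, -, k, -, rfl⟩ := D.τ_eq τ
    have h1 : σ ^ k • J = J := by
      simp only [J]
      rw [Finset.smul_prod']
      exact Finset.prod_congr rfl fun i _ => hδiA i k
    rw [mul_smul, h1]
    clear h1
    induction i with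
    | zero => simp
    | succ i ih => rw [pow_succ, mul_smul, hδJ, ih]
  obtain ⟨k, a, ha, hJa⟩ := D.inv_ideal R hRs hRi hRp _ J le_rfl hJ0 hJ
  refine ⟨k, ?_⟩
  have e1 : cl J = cl I ^ (p - 1) := by
    simp only [J]
    rw [cl_prod _ _ fun i => smul_ne_bot _ _ hA0]
    rw [Finset.prod_congr rfl fun i _ => by
      rw [← act_cl _ _ hA0, hAc, act_pow_fix δ _ hδ i]]
    simp
  rw [← e1, hJa, cl_span_mul a ha _ (pow_ne_zero k hRs.ne_zero), cl_pow _ hRs.ne_zero]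

theorem card_Z (κ : G) (hκ : κ * σ = σ ^ (p - 1) * κ) (m : ℕ) (hm : κ = δ ^ m)
    [Finite (ClassGroup O)]
    (hunit : ∀ ε η : Oˣ, σ • (ε : O) = ε → (ε : O) * κ • (ε : O) = Nm p σ (η : O) →
      ∃ (j : ℕ) (v : Oˣ), (ε : O) = ζ ^ j * Nm p σ (v : O)) :
    Nat.card {c : ClassGroup O // c ^ p = 1 ∧ act σ c = c ∧ act δ c = c} ≤ p := by
  have hp1 : p = (p - 1) + 1 := (Nat.sub_add_cancel D.hp.one_le).symm
  have : NeZero p := ⟨D.hp.ne_zero⟩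
  have hA : ∀ c : {c : ClassGroup O // c ^ p = 1 ∧ act σ c = c ∧ act δ c = c}, _ := fun c =>
    D.claimA κ hκ hunit c.1 c.2.2.1 (by rw [hm]; exact act_pow_fix δ _ c.2.2.2 m)
  choose I x y j hI hc hx hy h hj using hA
  by_cases hp2 : p ^ 2 ∣ N - 1
  · let φ : {c : ClassGroup O // c ^ p = 1 ∧ act σ c = c ∧ act δ c = c} → ZMod p := fun c => (j c : ZMod p)
    suffices hφ : Function.Injective φ by
      have := Nat.card_le_card_of_injective φ hφ
      rwa [Nat.card_zmod] at this
    intro c c' hcc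
    have hjj : (j c : ZMod p) = j c' := hcc
    have key := D.claimF3 (Ideal.span {1 - ζ}) (D.sqfree_π hp2) D.π_inv
      (fun P hP => by rw [Ideal.dvd_span_singleton, D.p_mem_iff P])
      (I c * I c' ^ (p - 1)) (mul_ne_zero (hI c) (pow_ne_zero _ (hI c')))
      (x c * x c' ^ (p - 1)) (y c * y c' ^ (p - 1)) (mul_ne_zero (hx c) (pow_ne_zero _ (hx c')))
      (mul_ne_zero (hy c) (pow_ne_zero _ (hy c')))
      (by
        simp only [← Ideal.span_singleton_mul_span_singleton, ← Ideal.span_singleton_pow, smul_mul',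
          smul_pow']
        calc _ = (Ideal.span {y c} * σ • I c) * (Ideal.span {y c'} * σ • I c') ^ (p - 1) := by ring
          _ = _ := by rw [h c, h c']; ring)
      (by
        rw [Nm_mul, Nm_mul, Nm_pow, Nm_pow, hj c, hj c']
        have : ζ ^ (j c) * (ζ ^ (j c')) ^ (p - 1) = 1 := by
          rw [← pow_mul, ← pow_add, D.ζpow_eq_one_iff, ← ZMod.natCast_eq_zero_iff]
          push_cast
          rw [Nat.cast_sub D.hp.one_le, hjj]; simp
        rw [mul_pow]
        linear_combination Nm p σ (y c) * Nm p σ (y c') ^ (p - 1) * this)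
      (by
        rw [cl_mul _ _ (hI c) (pow_ne_zero _ (hI c')), cl_pow _ (hI c'), hc, hc, map_mul, map_pow,
          c.2.2.2, c'.2.2.2])
    obtain ⟨k, hk⟩ := key
    rw [cl_span _ D.π_ne, one_pow, cl_mul _ _ (hI c) (pow_ne_zero _ (hI c')), cl_pow _ (hI c'), hc,
      hc] at hk
    have hp' : (c.1 * c'.1 ^ (p - 1)) ^ p = 1 := by
      rw [mul_pow, ← pow_mul, mul_comm (p - 1), pow_mul, c.2.1, c'.2.1, one_pow, one_mul]
    have h1 : c.1 * c'.1 ^ (p - 1) = 1 := by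
      have h3 := pow_succ (c.1 * c'.1 ^ (p - 1)) (p - 1)
      rw [← hp1, hp', hk, one_mul] at h3; exact h3.symm
    have h2 : c'.1 * c'.1 ^ (p - 1) = 1 := by
      rw [← pow_succ', ← hp1]; exact c'.2.1
    exact Subtype.ext (mul_right_cancel (h1.trans h2.symm))
  · set R := (Ideal.span {(p : O)}).radical
    have hmem : ∀ c : {c : ClassGroup O // c ^ p = 1 ∧ act σ c = c ∧ act δ c = c},
        c.1 ∈ Subgroup.zpowers (cl R) := by
      intro c
      have hpj := (D.claimF2 (I c) (hI c) (x c) (y c) (hx c) (hy c) (h c) (j c) (hj c)).resolve_right hp2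
      obtain ⟨k, hk⟩ := D.claimF3 R (radical_sqfree _ (by simp [D.hp.ne_zero])) (radical_inv p)
        (fun P hP => dvd_radical_iff p P hP) (I c) (hI c) (x c) (y c) (hx c) (hy c) (h c)
        (by rw [hj c, (D.ζpow_eq_one_iff _).2 hpj, one_mul]) (by rw [hc]; exact c.2.2.2)
      rw [hc] at hk
      have h1 : c.1 = (cl R ^ k)⁻¹ := by
        rw [← hk, eq_inv_iff_mul_eq_one, ← pow_succ', ← hp1]; exact c.2.1
      rw [h1]
      exact Subgroup.inv_mem _ (Subgroup.npow_mem_zpowers _ _)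
    let φ : {c : ClassGroup O // c ^ p = 1 ∧ act σ c = c ∧ act δ c = c} →
        {g : Subgroup.zpowers (cl R) // g ^ p = 1} := fun c =>
      ⟨⟨c.1, hmem c⟩, Subtype.ext c.2.1⟩
    have hφ : Function.Injective φ := by
      intro c c' hcc
      apply Subtype.ext
      exact congrArg (fun g => ((g.1 : Subgroup.zpowers (cl R)) : ClassGroup O)) hcc
    have h1 := Nat.card_le_card_of_injective φ hφ
    refine h1.trans ?_
    classical
    have : Fintype (Subgroup.zpowers (cl R)) := Fintype.ofFinite _
    have h2 := IsCyclic.card_pow_eq_one_le (α := Subgroup.zpowers (cl R)) D.hp.pos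
    rw [Nat.card_eq_fintype_card, Fintype.card_subtype]
    exact h2

end
end KData
end Kum

end

section
open Module
open scoped Pointwise

namespace Kum

section tor
/-- The `p`-torsion of a commutative group, written additively. -/
abbrev Tor (p : ℕ) (C : Type*) [CommGroup C] : Type _ :=
  Additive ((powMonoidHom p : C →* C).ker)

noncomputable instance torModule (p : ℕ) (C : Type*) [CommGroup C] : Module (ZMod p) (Tor p C) :=
  AddCommGroup.zmodModule (by
    intro x
    apply Additive.toMul.injective
    apply Subtype.ext
    exact x.toMul.2)

variable {p : ℕ} {C : Type*} [CommGroup C]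

def mkT (c : C) (h : c ^ p = 1) : Tor p C := Additive.ofMul ⟨c, h⟩

def unT (x : Tor p C) : C := x.toMul.1

theorem unT_pow (x : Tor p C) : unT x ^ p = 1 := x.toMul.2
theorem unT_mkT (c : C) (h : c ^ p = 1) : unT (mkT c h : Tor p C) = c := rfl
theorem unT_inj (x y : Tor p C) (h : unT x = unT y) : x = y :=
  Additive.toMul.injective (Subtype.ext h)
theorem unT_zero : unT (0 : Tor p C) = 1 := rfl
theorem unT_add (x y : Tor p C) : unT (x + y) = unT x * unT y := rfl
theorem unT_nsmul (n : ℕ) (x : Tor p C) : unT (n • x) = unT x ^ n := by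
  induction n with
  | zero => simp [unT_zero]
  | succ n ih => rw [succ_nsmul, unT_add, ih, pow_succ]
theorem unT_smul [NeZero p] (a : ZMod p) (x : Tor p C) : unT (a • x) = unT x ^ a.val := by
  rw [← unT_nsmul, ← Nat.cast_smul_eq_nsmul (ZMod p), ZMod.natCast_zmod_val]
theorem unT_sum {ι : Type*} (s : Finset ι) (f : ι → Tor p C) :
    unT (∑ i ∈ s, f i) = ∏ i ∈ s, unT (f i) := by
  classical
  induction s using Finset.induction_on with
  | empty => simp [unT_zero]
  | insert a s ha ih => rw [Finset.sum_insert ha, Finset.prod_insert ha, unT_add, ih]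

/-- induced map -/
noncomputable def mapT {C' : Type*} [CommGroup C'] (f : C →* C') : Tor p C →ₗ[ZMod p] Tor p C' :=
  AddMonoidHom.toZModLinearMap p
    { toFun := fun x => mkT (f (unT x)) (by rw [← map_pow, unT_pow, map_one])
      map_zero' := unT_inj _ _ (by rw [unT_mkT, unT_zero, map_one, unT_zero])
      map_add' := fun x y => unT_inj _ _ (by
        rw [unT_mkT, unT_add, map_mul, unT_add, unT_mkT, unT_mkT]) }

theorem unT_mapT {C' : Type*} [CommGroup C'] (f : C →* C') (x : Tor p C) :
    unT (mapT f x : Tor p C') = f (unT x) := rfl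

instance [Finite C] : Finite (Tor p C) := inferInstanceAs (Finite ((powMonoidHom p : C →* C).ker))

instance [Finite C] : Module.Finite (ZMod p) (Tor p C) := Module.Finite.of_finite

theorem card_tor [Fact p.Prime] [Finite C] :
    Nat.card {g : C // g ^ p = 1} = p ^ finrank (ZMod p) (Tor p C) := by
  have := Module.natCard_eq_pow_finrank (K := ZMod p) (V := Tor p C)
  rw [Nat.card_zmod] at this
  rw [← this]
  rfl
end tor

namespace KData
variable {O G : Type*} [CommRing O] [IsDomain O] [IsDedekindDomain O] [CharZero O]
  [Module.Free ℤ O] [Module.Finite ℤ O]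
  [Group G] [Finite G] [MulSemiringAction G O] [IsGaloisGroup G ℤ O]
  {p N : ℕ} {u : (ZMod p)ˣ} {ζ α : O} {σ δ : G} 

section
variable (D : KData p N u ζ α σ δ)
include D

theorem val_fact (Q : Ideal O) [hQ : Q.IsPrime] (hα : α ∈ Q) (hQ0 : Q ≠ ⊥) (A B : O) (hA : A ≠ 0)
    (hB : B ≠ 0)
    (h : σ • A * B = A * σ • B) (m n : ℕ) (I J : Ideal O) (hI : ¬ I ≤ Q) (hJ : ¬ J ≤ Q)
    (hAI : Ideal.span {A} = Q ^ m * I) (hBJ : Ideal.span {B} = Q ^ n * J) :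
    (m : ZMod p) = n := by
  wlog hmn : n ≤ m generalizing A B m n I J
  · exact (this B A hB hA (by rw [mul_comm, ← h, mul_comm]) n m J I hJ hI hBJ hAI (by omega)).symm
  obtain ⟨k, rfl⟩ := Nat.exists_eq_add_of_le hmn
  suffices p ∣ k by
    push_cast
    rw [(ZMod.natCast_eq_zero_iff k p).2 this, add_zero]
  have hQdvd : Q ∣ Ideal.span {α} := by rwa [Ideal.dvd_span_singleton]
  obtain ⟨C, hC⟩ := hQdvd
  have hpr : Prime Q := Ideal.prime_of_isPrime hQ0 hQ
  have hCQ : ¬ C ≤ Q := by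
    intro hle
    rw [← Ideal.dvd_iff_le] at hle
    obtain ⟨E, rfl⟩ := hle
    have := D.sqfree_α Q ⟨E, by rw [hC]; ring⟩
    exact hpr.not_unit this
  have hJC : ¬ J * C ^ k ≤ Q := by
    intro hle
    rcases (hQ.mul_le).1 hle with h1 | h1
    · exact hJ h1
    · exact hCQ (hQ.le_of_pow_le h1)
  obtain ⟨s, t, hs, ht, hst⟩ := loc_frac Q (J * C ^ k) I hJC hI A (B * α ^ k) hA (by
    rw [← Ideal.span_singleton_mul_span_singleton, ← Ideal.span_singleton_pow, hC, hAI, hBJ]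
    ring)
  have h1 := congrArg (σ • ·) hst
  simp only [smul_mul', smul_pow', D.σα] at h1
  have hne : σ • B ≠ 0 := smul_ne0 _ _ hB
  have hαk : α ^ k ≠ 0 := pow_ne_zero _ D.α0
  have h2 : σ • t * s = t * σ • s * ζ ^ k := by
    apply mul_right_cancel₀ (mul_ne_zero (mul_ne_zero hne hB) hαk)
    rw [mul_pow] at h1
    linear_combination (-(σ • t) * σ • B) * hst - t * (σ • t) * h + (t * B) * h1
  have ht' := D.σ_inertia Q hα t
  have hs' := D.σ_inertia Q hα s
  by_contra hk
  apply D.p_not_mem Q hα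
  apply D.p_mem_of Q k hk
  have h3 : t * s * (ζ ^ k - 1) ∈ Q := by
    have : t * s * (ζ ^ k - 1) = (σ • t - t) * s - (σ • s - s) * (t * ζ ^ k) := by
      linear_combination -h2
    rw [this]
    exact Q.sub_mem (Q.mul_mem_right _ ht') (Q.mul_mem_right _ hs')
  rcases hQ.mem_or_mem h3 with h4 | h4
  · rcases hQ.mem_or_mem h4 with h5 | h5
    · exact absurd h5 ht
    · exact absurd h5 hs
  · exact h4

end
end KData

section unitsact
variable {O G : Type*} [CommRing O] [Group G] [MulSemiringAction G O]

/-- action on units, additively -/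
def uact (τ : G) : Module.End ℤ (Additive Oˣ) :=
  (MonoidHom.toAdditive (Units.map (MulSemiringAction.toRingHom G O τ : O →* O))).toIntLinearMap

theorem uact_apply (τ : G) (e : Additive Oˣ) : ((uact τ e).toMul : O) = τ • (e.toMul : O) := rfl

theorem uact_ext (e e' : Additive Oˣ) (h : (e.toMul : O) = e'.toMul) : e = e' :=
  Additive.toMul.injective (Units.ext h)

theorem uact_pow (τ : G) (k : ℕ) (e : Additive Oˣ) :
    ((((uact τ) ^ k) e).toMul : O) = τ ^ k • (e.toMul : O) := by
  induction k with
  | zero => simp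
  | succ k ih => rw [pow_succ', Module.End.mul_apply, uact_apply, ih, pow_succ', mul_smul]

theorem uact_sum {ι : Type*} (s : Finset ι) (f : ι → Additive Oˣ) :
    (((∑ i ∈ s, f i).toMul : Oˣ) : O) = ∏ i ∈ s, ((f i).toMul : O) := by
  rw [toMul_sum, Units.coe_prod]

theorem uact_Nm (p : ℕ) (τ : G) (e : Additive Oˣ) :
    (((∑ i ∈ Finset.range p, (uact τ) ^ i) e).toMul : O) = Nm p τ (e.toMul : O) := by
  rw [LinearMap.sum_apply, uact_sum]
  exact Finset.prod_congr rfl fun i _ => uact_pow τ i e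
end unitsact

end Kum

end

section
open Module
open scoped Pointwise

namespace Kum
namespace KData
variable {O G : Type*} [CommRing O] [IsDomain O] [IsDedekindDomain O] [CharZero O]
  [Module.Free ℤ O] [Module.Finite ℤ O]
  [Group G] [Finite G] [MulSemiringAction G O] [IsGaloisGroup G ℤ O]
  {p N : ℕ} {u : (ZMod p)ˣ} {ζ α : O} {σ δ : G} 

theorem mapT_act_pow (p : ℕ) (τ : G) (k : ℕ) (x : Tor p (ClassGroup O)) :
    unT (((mapT (act τ) : Module.End (ZMod p) (Tor p (ClassGroup O))) ^ k) x) = act (τ ^ k) (unT x) := by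
  induction k with
  | zero => simp [act_one]
  | succ k ih => rw [pow_succ', Module.End.mul_apply, unT_mapT, ih, pow_succ', act_mul]

section
variable (D : KData p N u ζ α σ δ)
include D

theorem card_X (q : Ideal O) [hq : q.IsPrime] (hα : α ∈ q) (h : ℕ) (hh : ¬ p ∣ h)
    [Module.Finite ℤ (Additive Oˣ)] (t : Additive Oˣ)
    (ht : ∀ x : Additive Oˣ, (∃ n : ℤ, n ≠ 0 ∧ n • x = 0) → x ∈ AddSubgroup.zmultiples t)
    (hr : finrank ℤ (Additive Oˣ) ≤ finrank ℤ (LinearMap.range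
      (∑ i ∈ Finset.range p, (uact σ : Module.End ℤ (Additive Oˣ)) ^ i)) + (p - 1) * ((p - 1) / 2)) :
    Nat.card {f : Fin (p - 1) → ZMod p //
      cl (∏ i : Fin (p - 1), (δ ^ (i : ℕ) • q) ^ (h * (f i).val)) = 1} ≤ p ^ ((p - 1) / 2 + 1) := by
  have hq0 : q ≠ ⊥ := by rintro rfl; exact D.α0 (by simpa using hα)
  have : NeZero p := ⟨D.hp.ne_zero⟩
  have hQ0 : ∀ i : ℕ, δ ^ i • q ≠ ⊥ := fun i => smul_ne_bot _ _ hq0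
  set 𝔄 : (Fin (p - 1) → ZMod p) → Ideal O :=
    fun f => ∏ i : Fin (p - 1), (δ ^ (i : ℕ) • q) ^ (h * (f i).val) with h𝔄
  have h𝔄0 : ∀ f, 𝔄 f ≠ ⊥ := fun f =>
    Finset.prod_ne_zero_iff.2 fun i _ => pow_ne_zero _ (hQ0 i)
  have h𝔄σ : ∀ f, σ • 𝔄 f = 𝔄 f := by
    intro f
    simp only [h𝔄]
    rw [Finset.smul_prod']
    refine Finset.prod_congr rfl fun i _ => ?_
    rw [smul_pow', D.σ_stab _ (D.δα_mem q hα i)]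
  have hex : ∀ f : {f // cl (𝔄 f) = 1}, ∃ (g : O) (e : Oˣ), g ≠ 0 ∧ 𝔄 f.1 = Ideal.span {g} ∧ σ • g = e * g := by
    rintro ⟨f, hf⟩
    obtain ⟨g, hg⟩ := (cl_eq_one_iff _ (h𝔄0 f)).1 hf
    have hg0 : g ≠ 0 := by
      rintro rfl
      exact h𝔄0 f (by rw [hg]; simp)
    have h1 := h𝔄σ f
    rw [hg, smul_span] at h1
    obtain ⟨e, he⟩ := Ideal.span_singleton_eq_span_singleton.1 h1.symm
    exact ⟨g, e, hg0, hg, by rw [← he, mul_comm]⟩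
  choose g e hg0 hg he using hex
  apply card_units_bound p D.hp (uact σ : Module.End ℤ (Additive Oˣ)) ((p - 1) / 2) t ht ?_ hr
    (fun f => Additive.ofMul (e f))
  · intro f
    apply uact_ext
    rw [uact_Nm]
    have h1 := congrArg (Nm p σ) (he f)
    rw [Nm_mul, Nm_smul' p σ D.σp] at h1
    have h2 : 1 * Nm p σ (g f) = Nm p σ (e f : O) * Nm p σ (g f) := by rw [one_mul]; exact h1
    exact (mul_right_cancel₀ (D.Nm_ne0 _ (hg0 f)) h2).symm
  · intro f f' w hw
    have hw' : (e f : O) * σ • (w.toMul : O) = (w.toMul : O) * (e f' : O) := by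
      have h1 : Additive.ofMul (e f) + uact σ w = w + Additive.ofMul (e f') := by
        have := sub_eq_sub_iff_add_eq_add.1 hw
        exact this
      exact congrArg (fun z : Additive Oˣ => (z.toMul : O)) h1
    set W : O := (w.toMul : O) with hW
    have hWu : IsUnit W := w.toMul.isUnit
    have hfix : σ • (g f * W) * g f' = (g f * W) * σ • g f' := by
      rw [smul_mul', he f, he f']
      linear_combination (g f * g f') * hw'
    apply Subtype.ext
    funext i
    have hval : ∀ f'' : Fin (p - 1) → ZMod p,
        ¬ (∏ j ∈ Finset.univ.erase i, (δ ^ (j : ℕ) • q) ^ (h * (f'' j).val)) ≤ δ ^ (i : ℕ) • q := by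
      intro f'' hle
      have hpr : (δ ^ (i : ℕ) • q).IsPrime := inferInstance
      obtain ⟨j, hj, hjle⟩ := (hpr.prod_le).1 hle
      have hjle' := hpr.le_of_pow_le hjle
      have hmax : (δ ^ (j : ℕ) • q).IsMaximal :=
        Ring.DimensionLEOne.maximalOfPrime (hQ0 j) inferInstance
      have heq := hmax.eq_of_le hpr.ne_top hjle'
      have := D.δq_inj q hα j i j.2 i.2 heq
      exact (Finset.mem_erase.1 hj).1 (Fin.ext this)
    have hsplit : ∀ f'' : Fin (p - 1) → ZMod p, 𝔄 f'' = (δ ^ (i : ℕ) • q) ^ (h * (f'' i).val) *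
        ∏ j ∈ Finset.univ.erase i, (δ ^ (j : ℕ) • q) ^ (h * (f'' j).val) := by
      intro f''
      simp only [h𝔄]
      rw [← Finset.mul_prod_erase _ _ (Finset.mem_univ i)]
    have hfin := D.val_fact (δ ^ (i : ℕ) • q) (D.δα_mem q hα i) (hQ0 i) (g f * W) (g f')
      (mul_ne_zero (hg0 f) hWu.ne_zero) (hg0 f') hfix _ _ _ _ (hval f.1) (hval f'.1)
      (by rw [Ideal.span_singleton_mul_right_unit hWu, ← hg, hsplit])
      (by rw [← hg, hsplit])
    push_cast at hfin
    rw [ZMod.natCast_zmod_val, ZMod.natCast_zmod_val] at hfin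
    have : Fact p.Prime := ⟨D.hp⟩
    exact mul_left_cancel₀ (by rwa [Ne, ZMod.natCast_eq_zero_iff]) hfin
  · apply LinearMap.ext
    intro x
    apply uact_ext
    rw [uact_pow, D.σp, one_smul]; rfl

theorem span_bound [Fact p.Prime] [Finite (ClassGroup O)]
    (q : Ideal O) [hq : q.IsPrime] (hα : α ∈ q) (h : ℕ) (hh : ¬ p ∣ h)
    (hw : (cl q ^ h) ^ p = 1)
    [Module.Finite ℤ (Additive Oˣ)] (t : Additive Oˣ)
    (ht : ∀ x : Additive Oˣ, (∃ n : ℤ, n ≠ 0 ∧ n • x = 0) → x ∈ AddSubgroup.zmultiples t)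
    (hr : finrank ℤ (Additive Oˣ) ≤ finrank ℤ (LinearMap.range
      (∑ i ∈ Finset.range p, (uact σ : Module.End ℤ (Additive Oˣ)) ^ i)) + (p - 1) * ((p - 1) / 2)) :
    p ≤ 2 * finrank (ZMod p) (Submodule.span (ZMod p) (Set.range fun i : ℕ =>
      ((mapT (act δ) : Module.End (ZMod p) (Tor p (ClassGroup O))) ^ i) (mkT (cl q ^ h) hw))) + 3 := by
  have hq0 : q ≠ ⊥ := by rintro rfl; exact D.α0 (by simpa using hα)
  set T : Module.End (ZMod p) (Tor p (ClassGroup O)) := mapT (act δ)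
  set w : Tor p (ClassGroup O) := mkT (cl q ^ h) hw
  let Φ : (Fin (p - 1) → ZMod p) →ₗ[ZMod p] Tor p (ClassGroup O) :=
    Fintype.linearCombination (ZMod p) (fun i : Fin (p - 1) => (T ^ (i : ℕ)) w)
  have hΦ : ∀ f, unT (Φ f) = cl (∏ i : Fin (p - 1), (δ ^ (i : ℕ) • q) ^ (h * (f i).val)) := by
    intro f
    simp only [Φ]
    rw [Fintype.linearCombination_apply, unT_sum, cl_prod]
    · refine Finset.prod_congr rfl fun i _ => ?_
      rw [unT_smul, mapT_act_pow, cl_pow _ (smul_ne_bot _ _ hq0), ← act_cl _ _ hq0, pow_mul]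
      congr 1
      rw [← map_pow]; rfl
    · intro i; exact pow_ne_zero _ (smul_ne_bot _ _ hq0)
  have hcard : Nat.card (LinearMap.ker Φ) ≤ p ^ ((p - 1) / 2 + 1) := by
    refine le_trans ?_ (D.card_X q hα h hh t ht hr)
    refine Nat.card_le_card_of_injective
      (fun f : LinearMap.ker Φ => ⟨f.1, ?_⟩) ?_
    · rw [← hΦ, LinearMap.mem_ker.1 f.2, unT_zero]
    · intro f f' hff
      have h5 := Subtype.ext_iff.1 hff
      exact Subtype.ext h5
  rw [Module.natCard_eq_pow_finrank (K := ZMod p), Nat.card_zmod] at hcard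
  have h1 := (Nat.pow_le_pow_iff_right D.hp.one_lt).1 hcard
  have h2 := LinearMap.finrank_range_add_finrank_ker Φ
  rw [Module.finrank_fin_fun] at h2
  have h3 : finrank (ZMod p) (LinearMap.range Φ) ≤ finrank (ZMod p)
      (Submodule.span (ZMod p) (Set.range fun i : ℕ => (T ^ i) w)) := by
    apply Submodule.finrank_mono
    rw [Fintype.range_linearCombination]
    apply Submodule.span_mono
    rintro _ ⟨i, rfl⟩
    exact ⟨i, rfl⟩
  have hodd := D.hp.odd_of_ne_two (by have := D.hp2; omega)
  obtain ⟨m, hm⟩ := hodd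
  omega

theorem main_abstract [Fact p.Prime] [Finite (ClassGroup O)]
    (h : ℕ) (hh : ¬ p ∣ h)
    (hw : ∀ q : Ideal O, q.IsPrime → α ∈ q → (cl q ^ h) ^ p = 1)
    [Module.Finite ℤ (Additive Oˣ)] (t : Additive Oˣ)
    (ht : ∀ x : Additive Oˣ, (∃ n : ℤ, n ≠ 0 ∧ n • x = 0) → x ∈ AddSubgroup.zmultiples t)
    (hr : finrank ℤ (Additive Oˣ) ≤ finrank ℤ (LinearMap.range
      (∑ i ∈ Finset.range p, (uact σ : Module.End ℤ (Additive Oˣ)) ^ i)) + (p - 1) * ((p - 1) / 2))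
    (hunit : ∀ κ : G, (κ • ζ) * ζ = 1 → ∀ ε η : Oˣ, σ • (ε : O) = ε →
      (ε : O) * κ • (ε : O) = Nm p σ (η : O) →
      ∃ (j : ℕ) (v : Oˣ), (ε : O) = ζ ^ j * Nm p σ (v : O)) :
    4 * finrank (ZMod p) (LinearMap.ker
      ((mapT (act δ) : Module.End (ZMod p) (Tor p (ClassGroup O))) - 1)) + p ≤
      2 * finrank (ZMod p) (Tor p (ClassGroup O)) + 7 := by
  obtain ⟨q, hq, hq0, hα⟩ := D.exists_q
  have hw' := hw q hq hα
  obtain ⟨m, hκζ, hκσ⟩ := D.exists_κ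
  have key := D.card_Z (δ ^ m) hκσ m rfl (hunit (δ ^ m) hκζ)
  refine la_main p D.hp2 (mapT (act σ)) (mapT (act δ)) u D.u_ne_one ?_ ?_ (mkT (cl q ^ h) hw') ?_
    (D.span_bound q hα h hh hw' t ht hr) ?_
  · apply LinearMap.ext
    intro x
    apply unT_inj
    rw [mapT_act_pow, D.σp, act_one]; rfl
  · apply LinearMap.ext
    intro x
    apply unT_inj
    rw [Module.End.mul_apply, Module.End.mul_apply, unT_mapT, unT_mapT, mapT_act_pow, unT_mapT,
      ← act_mul, D.δσ, act_mul]
  · apply unT_inj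
    rw [unT_sum, unT_zero]
    have : ∀ i : ℕ, unT (((mapT (act δ) : Module.End (ZMod p) (Tor p (ClassGroup O))) ^ i)
        (mkT (cl q ^ h) hw')) = cl (δ ^ i • q) ^ h := by
      intro i
      rw [mapT_act_pow, unT_mkT, map_pow, act_cl _ _ hq0]
    rw [Finset.prod_congr rfl fun i _ => this i, Finset.prod_pow,
      ← cl_prod _ _ fun i => smul_ne_bot _ _ hq0, D.prod_δq q hα, cl_span _ D.α0, one_pow]
  · set Z := LinearMap.ker ((mapT (act σ) : Module.End (ZMod p) (Tor p (ClassGroup O))) - 1) ⊓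
      LinearMap.ker ((mapT (act δ) : Module.End (ZMod p) (Tor p (ClassGroup O))) - 1)
    have h1 : Nat.card Z ≤ p := by
      refine le_trans ?_ key
      refine Nat.card_le_card_of_injective (fun x : Z => ⟨unT x.1, unT_pow x.1, ?_, ?_⟩) ?_
      · have := LinearMap.mem_ker.1 (Submodule.mem_inf.1 x.2).1
        rw [LinearMap.sub_apply, sub_eq_zero] at this
        exact congrArg unT this
      · have := LinearMap.mem_ker.1 (Submodule.mem_inf.1 x.2).2
        rw [LinearMap.sub_apply, sub_eq_zero] at this
        exact congrArg unT this
      · intro x y hxy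
        have h5 := Subtype.ext_iff.1 hxy
        exact Subtype.ext (unT_inj _ _ h5)
    rw [Module.natCard_eq_pow_finrank (K := ZMod p), Nat.card_zmod] at h1
    conv_rhs at h1 => rw [← pow_one p]
    exact (Nat.pow_le_pow_iff_right D.hp.one_lt).1 h1
end
end KData
end Kum

end

section
open Module
open scoped Pointwise

namespace Kum

section ext
variable {R O : Type*} [CommRing O] [IsDomain O] [IsDedekindDomain O]
  [CommRing R] [IsDomain R] [IsDedekindDomain R] [Algebra R O] [Module.Finite R O]
  [Module.IsTorsionFree R O]

theorem ext_cl (I : Ideal R) (hI : I ≠ ⊥) :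
    I.map (algebraMap R O) ≠ ⊥ ∧
    ClassGroup.extendedHom R O (cl I) = cl (I.map (algebraMap R O)) := by
  have h : I.map (algebraMap R O) ≠ ⊥ := by
    rw [Ne, Ideal.map_eq_bot_iff_of_injective (FaithfulSMul.algebraMap_injective R O)]
    exact hI
  refine ⟨h, ?_⟩
  rw [cl_eq I hI, cl_eq _ h, ClassGroup.extendedHom_mk0]

theorem ext_inj (c : ClassGroup R) (h : ClassGroup.extendedHom R O c = 1) :
    c ^ finrank R O = 1 := by
  obtain ⟨I, hI, rfl⟩ := exists_cl c
  obtain ⟨h1, h2⟩ := ext_cl (O := O) I hI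
  rw [h2, cl_eq_one_iff _ h1] at h
  obtain ⟨x, hx⟩ := h
  rw [← cl_pow _ hI, cl_eq_one_iff _ (pow_ne_zero _ hI)]
  refine ⟨Algebra.intNorm R O x, ?_⟩
  rw [← Ideal.relNorm_singleton, ← hx, Ideal.relNorm_algebraMap]

theorem ext_rank {G : Type*} [Group G] [MulSemiringAction G O] {p : ℕ} [Fact p.Prime]
    [Finite (ClassGroup O)] [Finite (ClassGroup R)]
    (hfin : finrank R O = p - 1) (δ : G) (hδ : ∀ x : R, δ • algebraMap R O x = algebraMap R O x) :
    finrank (ZMod p) (Tor p (ClassGroup R)) ≤ finrank (ZMod p)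
      (LinearMap.ker ((mapT (act δ) : Module.End (ZMod p) (Tor p (ClassGroup O))) - 1)) := by
  have hp : p.Prime := Fact.out
  let f : Tor p (ClassGroup R) →ₗ[ZMod p] Tor p (ClassGroup O) :=
    mapT (ClassGroup.extendedHom R O)
  have hf : Function.Injective f := by
    rw [injective_iff_map_eq_zero]
    intro x hx
    apply unT_inj
    rw [unT_zero]
    have h1 : ClassGroup.extendedHom R O (unT x) = 1 := by
      rw [← unT_mapT]; change unT (f x) = 1; rw [hx, unT_zero]
    have h2 := ext_inj _ h1
    rw [hfin] at h2
    have h3 := unT_pow x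
    have h4 : unT x ^ ((p - 1) + 1) = 1 :=
      (congrArg (fun n => unT x ^ n) (Nat.sub_add_cancel hp.one_le)).trans h3
    rw [pow_succ, h2, one_mul] at h4
    exact h4
  have hr : ∀ x, f x ∈ LinearMap.ker
      ((mapT (act δ) : Module.End (ZMod p) (Tor p (ClassGroup O))) - 1) := by
    intro x
    rw [LinearMap.mem_ker, LinearMap.sub_apply, sub_eq_zero]
    apply unT_inj
    change act δ (ClassGroup.extendedHom R O (unT x)) = ClassGroup.extendedHom R O (unT x)
    obtain ⟨I, hI, h⟩ := exists_cl (unT x)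
    obtain ⟨h1, h2⟩ := ext_cl (O := O) I hI
    rw [← h, h2, act_cl _ _ h1]
    congr 1
    rw [Ideal.pointwise_smul_def, Ideal.map_map]
    congr 1
    ext x
    exact hδ x
  exact LinearMap.finrank_le_finrank_of_injective (f := f.codRestrict _ hr)
    (fun a b hab => hf (congrArg Subtype.val hab))
end ext

namespace KData
variable {O G : Type*} [CommRing O] [IsDomain O] [IsDedekindDomain O] [CharZero O]
  [Module.Free ℤ O] [Module.Finite ℤ O]
  [Group G] [Finite G] [MulSemiringAction G O] [IsGaloisGroup G ℤ O]
  {p N : ℕ} {u : (ZMod p)ˣ} {ζ α : O} {σ δ : G}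

set_option maxHeartbeats 1000000 in
theorem hw_rel (D : KData p N u ζ α σ δ) {R : Type*} [CommRing R] [IsDomain R] [IsDedekindDomain R]
    [Algebra R O] [Module.Finite R O] [Module.IsTorsionFree R O]
    (hfin : finrank R O = p) (ζR : R) (hζR : algebraMap R O ζR = ζ) (q : Ideal O) (hq : q.IsPrime)
    (hα : α ∈ q) : (cl q ^ (Nat.card (ClassGroup R))) ^ p = 1 := by
  have hq0 : q ≠ ⊥ := by rintro rfl; exact D.α0 (by simpa using hα)
  set v : Ideal R := q.comap (algebraMap R O) with hv
  have hvN : (N : R) ∈ v := by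
    rw [hv, Ideal.mem_comap, map_natCast]; exact (D.α_mem_iff q).1 hα
  have hvp : v.IsPrime := Ideal.comap_isPrime _ _
  have hv0 : v ≠ ⊥ := by
    intro h
    rw [h, Ideal.mem_bot] at hvN
    have := congrArg (algebraMap R O) hvN
    rw [map_natCast, map_zero] at this
    exact D.hN.ne_zero (by exact_mod_cast this)
  obtain ⟨h1, h2⟩ := ext_cl (O := O) v hv0
  obtain ⟨m, J, hm, hJ⟩ := split_q q _ hq0 h1
  have hJt : J = ⊤ := by
    by_contra hne
    obtain ⟨Q, hQm, hJQ⟩ := Ideal.exists_le_maximal J hne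
    have hQ := hQm.isPrime
    have hvQ : v.map (algebraMap R O) ≤ Q := by
      rw [hm]; exact le_trans Ideal.mul_le_right hJQ
    have hvQ' : ∀ x ∈ v, algebraMap R O x ∈ Q := fun x hx => hvQ (Ideal.mem_map_of_mem _ hx)
    have hNQ : (N : O) ∈ Q := by simpa using hvQ' _ hvN
    have hαQ := (D.α_mem_iff Q).2 hNQ
    obtain ⟨i, hi, hQi⟩ := D.over_N q Q hα hαQ
    obtain ⟨z, hz⟩ := D.ζ_int q hα
    have hz1 : ζ - z ∈ Q := by
      have := hvQ' (ζR - z) (by rw [hv, Ideal.mem_comap]; simpa [hζR] using hz)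
      simpa [hζR] using this
    have hz2 : δ ^ i • (ζ - z) ∈ Q := by
      rw [hQi]; exact (mem_smul_iff _ _ _).2 hz
    rw [smul_sub, smul_intCast'] at hz2
    have h3 : δ ^ i • ζ = ζ := D.inertia_ζ Q (D.p_not_mem Q hαQ) _ (by
      convert Q.sub_mem hz2 hz1 using 1; ring)
    have h4 := D.δζ_inj i 0 hi (by have := D.hp2; omega) (by rw [h3, pow_zero, one_smul])
    rw [h4, pow_zero, one_smul] at hQi
    rw [hQi] at hJQ
    exact hJ hJQ
  rw [hJt, Ideal.mul_top] at hm
  have : q.LiesOver v := ⟨rfl⟩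
  obtain ⟨s, hs⟩ := Ideal.exists_relNorm_eq_pow_of_isPrime q v
  have h3 := Ideal.relNorm_algebraMap O v
  rw [hm, map_pow, hs, hfin, ← pow_mul] at h3
  have h4 : s * m = p := by
    have hvpr : Prime v := Ideal.prime_of_isPrime hv0 hvp
    exact pow_injective_of_not_isUnit hvpr.not_unit hvpr.ne_zero h3
  have h5 : (cl q ^ m) ^ Nat.card (ClassGroup R) = 1 := by
    rw [← cl_pow _ hq0, ← hm, ← h2, ← map_pow, pow_card_eq_one', map_one]
  rw [← h4, mul_comm s m, pow_mul, ← pow_mul (cl q), mul_comm _ m, pow_mul (cl q), h5, one_pow]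

end KData
end Kum

end

section
open Module
open scoped Pointwise

namespace Kum
open Polynomial

section fields

theorem exists_hom {E L : Type*} [Field E] [Field L] [NumberField E] [NumberField L]
    (x : E) (h : Algebra.adjoin ℚ {x} = (⊤ : Subalgebra ℚ E)) (f : ℚ[X]) (hf : minpoly ℚ x = f)
    (y : L) (hy : aeval y f = 0) :
    finrank ℚ E = f.natDegree ∧ ∃ φ : E →ₐ[ℚ] L, φ x = y := by
  subst hf
  have hx : IsIntegral ℚ x := Algebra.IsIntegral.isIntegral x
  let pb := PowerBasis.ofAdjoinEqTop hx h
  have hg : pb.gen = x := PowerBasis.ofAdjoinEqTop_gen hx h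
  refine ⟨?_, pb.lift y (by rw [hg]; exact hy), ?_⟩
  · rw [pb.finrank, ← pb.natDegree_minpoly, hg]
  · have := pb.lift_gen y (by rw [hg]; exact hy)
    exact (congrArg _ hg.symm).trans this

theorem not_pow (p N : ℕ) (hp : p.Prime) (hN : N.Prime) (b : ℚ) : b ^ p ≠ (N : ℚ) := by
  intro h
  have : Fact N.Prime := ⟨hN⟩
  have h1 := congrArg (padicValRat N) h
  have hb : b ≠ 0 := by
    rintro rfl
    rw [zero_pow hp.ne_zero] at h
    exact hN.ne_zero (by exact_mod_cast h.symm)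
  rw [padicValRat.pow, padicValRat.of_nat, padicValNat_self] at h1
  have h2 : (p : ℤ) ∣ 1 := ⟨_, h1.symm⟩
  have h3 : p ∣ 1 := by exact_mod_cast h2
  exact hp.one_lt.ne' (Nat.dvd_one.1 h3)

theorem minpoly_β (p N : ℕ) (hp : p.Prime) (hN : N.Prime) {E : Type*} [Field E] [NumberField E]
    (x : E) (hx : x ^ p = (N : E)) : minpoly ℚ x = X ^ p - C (N : ℚ) := by
  symm
  refine minpoly.eq_of_irreducible_of_monic
    (X_pow_sub_C_irreducible_of_prime hp (not_pow p N hp hN)) ?_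
    (monic_X_pow_sub_C _ hp.ne_zero)
  simp [hx]

variable {p N : ℕ} {L : Type*} [Field L] [NumberField L] {ζ α : L}

theorem isGalois (hp : p.Prime) (hζ : IsPrimitiveRoot ζ p) (hα : α ^ p = (N : L))
    (hLgen : Algebra.adjoin ℚ {ζ, α} = (⊤ : Subalgebra ℚ L)) (hN : N.Prime) : IsGalois ℚ L := by
  have hN0 : (N : L) ≠ 0 := by exact_mod_cast hN.ne_zero
  have hα0 : α ≠ 0 := by rintro rfl; rw [zero_pow hp.ne_zero] at hα; exact hN0 hα.symm
  have hsp : ((X ^ p - C (N : ℚ)).map (algebraMap ℚ L)).Splits := by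
    have := X_pow_sub_C_splits_of_isPrimitiveRoot hζ hα
    simpa using this
  have hne : (X ^ p - C (N : ℚ)) ≠ 0 := (monic_X_pow_sub_C _ hp.ne_zero).ne_zero
  have hαr : α ∈ (X ^ p - C (N : ℚ)).rootSet L := by
    rw [mem_rootSet]; exact ⟨hne, by simp [hα]⟩
  have hζr : ζ * α ∈ (X ^ p - C (N : ℚ)).rootSet L := by
    rw [mem_rootSet]; exact ⟨hne, by simp [hα, mul_pow, hζ.pow_eq_one]⟩
  have : IsSplittingField ℚ L (X ^ p - C (N : ℚ)) := by
    refine ⟨hsp, ?_⟩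
    have halg : Algebra.adjoin ℚ ((X ^ p - C (N : ℚ)).rootSet L) =
        (IntermediateField.adjoin ℚ ((X ^ p - C (N : ℚ)).rootSet L)).toSubalgebra := by
      rw [IntermediateField.adjoin_toSubalgebra_of_isAlgebraic]
      intro x _
      exact Algebra.IsAlgebraic.isAlgebraic x
    rw [halg, eq_top_iff, ← hLgen]
    apply Algebra.adjoin_le
    have h1 := IntermediateField.subset_adjoin ℚ _ hαr
    have h2 := IntermediateField.subset_adjoin ℚ _ hζr
    intro x hx
    rcases hx with rfl | hx
    · have := div_mem h2 h1
      rwa [mul_div_cancel_right₀ _ hα0] at this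
    · rw [Set.mem_singleton_iff] at hx; rw [hx]; exact h1
  have : Normal ℚ L := Normal.of_isSplittingField (X ^ p - C (N : ℚ))
  exact ⟨⟩

/-- Existence of automorphisms with prescribed values. -/
theorem galois_data (hp : p.Prime) (hζ : IsPrimitiveRoot ζ p) (hα : α ^ p = (N : L))
    (hLgen : Algebra.adjoin ℚ {ζ, α} = (⊤ : Subalgebra ℚ L)) (hN : N.Prime)
    (hdeg : p * (p - 1) ∣ finrank ℚ L) :
    (∀ τ : L ≃ₐ[ℚ] L, τ ζ = ζ → τ α = α → τ = 1) ∧ finrank ℚ L = p * (p - 1) ∧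
    ∀ (a : (ZMod p)ˣ) (b : ZMod p), ∃ τ : L ≃ₐ[ℚ] L, τ ζ = ζ ^ (a : ZMod p).val ∧
      τ α = ζ ^ b.val * α := by
  have : Fact p.Prime := ⟨hp⟩
  have hG := isGalois hp hζ hα hLgen hN
  have hN0 : (N : L) ≠ 0 := by exact_mod_cast hN.ne_zero
  have hα0 : α ≠ 0 := by rintro rfl; rw [zero_pow hp.ne_zero] at hα; exact hN0 hα.symm
  have hext : ∀ τ τ' : L ≃ₐ[ℚ] L, τ ζ = τ' ζ → τ α = τ' α → τ = τ' := by
    intro τ τ' h1 h2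
    have : (τ : L →ₐ[ℚ] L) = τ' := by
      apply AlgHom.ext_of_adjoin_eq_top hLgen
      intro x hx
      rcases hx with rfl | hx
      · exact h1
      · rw [Set.mem_singleton_iff] at hx; rw [hx]; exact h2
    ext x
    exact DFunLike.congr_fun this x
  have h1 : ∀ τ : L ≃ₐ[ℚ] L, ∃ ab : (ZMod p)ˣ × ZMod p, τ ζ = ζ ^ (ab.1 : ZMod p).val ∧
      τ α = ζ ^ ab.2.val * α := by
    intro τ
    obtain ⟨i, hi, hi'⟩ := hζ.eq_pow_of_pow_eq_one (ξ := τ ζ)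
      (by rw [← map_pow, hζ.pow_eq_one, map_one])
    obtain ⟨j, hj, hj'⟩ := hζ.eq_pow_of_pow_eq_one (ξ := τ α / α)
      (by rw [div_pow, ← map_pow, hα, map_natCast, div_self hN0])
    have hi0 : (i : ZMod p) ≠ 0 := by
      intro h
      rw [ZMod.natCast_eq_zero_iff] at h
      have : i = 0 := Nat.eq_zero_of_dvd_of_lt h hi
      rw [this, pow_zero] at hi'
      have h2 : ζ = 1 := τ.injective (by rw [← hi', map_one])
      exact hζ.ne_one hp.one_lt h2
    refine ⟨(Units.mk0 _ hi0, (j : ZMod p)), ?_, ?_⟩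
    · rw [Units.val_mk0, ZMod.val_natCast, Nat.mod_eq_of_lt hi, hi']
    · simp only [ZMod.val_natCast, Nat.mod_eq_of_lt hj, hj']
      rw [div_mul_cancel₀ _ hα0]
  choose f hf1 hf2 using h1
  have hinj : Function.Injective f := by
    intro τ τ' h
    apply hext
    · rw [hf1, hf1, h]
    · rw [hf2, hf2, h]
  have hcard : Nat.card ((ZMod p)ˣ × ZMod p) = p * (p - 1) := by
    rw [Nat.card_prod, Nat.card_zmod, Nat.card_eq_fintype_card, ZMod.card_units, mul_comm]
  have hG' : Nat.card (L ≃ₐ[ℚ] L) = finrank ℚ L := IsGalois.card_aut_eq_finrank ℚ L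
  have hle : Nat.card (L ≃ₐ[ℚ] L) ≤ Nat.card ((ZMod p)ˣ × ZMod p) :=
    Nat.card_le_card_of_injective f hinj
  have hge := Nat.le_of_dvd finrank_pos hdeg
  have heq : finrank ℚ L = p * (p - 1) := by omega
  have hbij : Function.Bijective f := by
    rw [Nat.bijective_iff_injective_and_card]
    exact ⟨hinj, by omega⟩
  refine ⟨fun τ h2 h3 => hext τ 1 (by simpa using h2) (by simpa using h3), heq, fun a b => ?_⟩
  obtain ⟨τ, hτ⟩ := hbij.2 (a, b)
  refine ⟨τ, ?_, ?_⟩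
  · rw [hf1, hτ]
  · rw [hf2, hτ]
end fields
end Kum

end

section
open Module
open scoped Pointwise

namespace Kum
open Polynomial NumberField

section units
variable {K L : Type*} [Field K] [NumberField K] [Field L] [NumberField L]

theorem coe_smul (τ : L ≃ₐ[ℚ] L) (x : 𝓞 L) : ((τ • x : 𝓞 L) : L) = τ (x : L) := rfl

example (x : 𝓞 L)[IsGalois ℚ L] : IsGaloisGroup (L ≃ₐ[ℚ] L) ℤ (𝓞 L) := inferInstance

theorem torsion_gen : ∃ t : Additive (𝓞 L)ˣ, ∀ x : Additive (𝓞 L)ˣ,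
    (∃ n : ℤ, n ≠ 0 ∧ n • x = 0) → x ∈ AddSubgroup.zmultiples t := by
  obtain ⟨g, hg⟩ := IsCyclic.exists_generator (α := NumberField.Units.torsion L)
  refine ⟨Additive.ofMul (g : (𝓞 L)ˣ), ?_⟩
  rintro x ⟨n, hn, hx⟩
  have hx' : x.toMul ^ n = 1 := by
    have := congrArg Additive.toMul hx
    simpa using this
  have hmem : x.toMul ∈ NumberField.Units.torsion L := by
    rw [NumberField.Units.torsion, CommGroup.mem_torsion, isOfFinOrder_iff_zpow_eq_one]
    exact ⟨n, hn, hx'⟩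
  obtain ⟨k, hk⟩ := hg ⟨_, hmem⟩
  refine ⟨k, ?_⟩
  have := congrArg Subtype.val hk
  apply Additive.toMul.injective
  simpa using this

theorem rank_units {ζ : L} {p : ℕ} (hp : 2 < p) (hζ : IsPrimitiveRoot ζ p) :
    2 * (finrank ℤ (Additive (𝓞 L)ˣ) + 1) = finrank ℚ L := by
  rw [NumberField.Units.finrank_eq, NumberField.Units.rank]
  have h1 := InfinitePlace.card_add_two_mul_card_eq_rank L
  have h2 := InfinitePlace.card_eq_nrRealPlaces_add_nrComplexPlaces L
  have h3 := NumberField.InfinitePlace.IsPrimitiveRoot.nrRealPlaces_eq_zero_of_two_lt hp hζ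
  have h4 : 0 < Fintype.card (InfinitePlace L) := Fintype.card_pos
  omega

variable {p N : ℕ} [IsGalois ℚ L] [Algebra K L] {ζ α : 𝓞 L} {σ δ : L ≃ₐ[ℚ] L} {u : (ZMod p)ˣ}

theorem fix_K {ζK : K} (hKgen : Algebra.adjoin ℚ {ζK} = (⊤ : Subalgebra ℚ K))
    (hζζ : algebraMap K L ζK = ζ) (σ : L ≃ₐ[ℚ] L) (h : σ • ζ = ζ) (x : K) :
    σ (algebraMap K L x) = algebraMap K L x := by
  have h2 : ((σ : L →ₐ[ℚ] L).comp (Algebra.algHom ℚ K L)) = Algebra.algHom ℚ K L := by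
    apply AlgHom.ext_of_adjoin_eq_top hKgen
    intro x hx
    rw [Set.mem_singleton_iff] at hx
    subst hx
    change σ (algebraMap K L x) = algebraMap K L x
    rw [hζζ, ← coe_smul, h]
  exact DFunLike.congr_fun h2 x

theorem fixed_mem (D : KData p N u ζ α σ δ) {ζK : K} (hKgen : Algebra.adjoin ℚ {ζK} = (⊤ : Subalgebra ℚ K))
    (hζζ : algebraMap K L ζK = ζ) (hK : finrank ℚ K = p - 1) (hL : finrank ℚ L = p * (p - 1))
    (y : L) (hy : σ y = y) : ∃ x : K, algebraMap K L x = y := by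
  let φ : K →ₐ[ℚ] L := Algebra.algHom ℚ K L
  let E := IntermediateField.fixedField (Subgroup.zpowers σ)
  have hfix : ∀ z : L, σ z = z → z ∈ E := by
    intro z hz
    rw [IntermediateField.mem_fixedField_iff]
    intro f hf
    obtain ⟨k, rfl⟩ := (mem_powers_iff_mem_zpowers.2 hf)
    induction k with
    | zero => rfl
    | succ k ih =>
      have := ih (Subgroup.npow_mem_zpowers σ k)
      simp only [pow_succ, AlgEquiv.mul_apply, hz] at this ⊢
      exact this
  have h1 : φ.fieldRange ≤ E := by
    rintro _ ⟨x, rfl⟩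
    exact hfix _ (fix_K hKgen hζζ σ D.σζ x)
  have h2 : finrank E L = p := by
    rw [IntermediateField.finrank_fixedField_eq_card, D.card_zpowers]
  have h3 : finrank ℚ E * p = p * (p - 1) := by
    rw [← hL, ← h2, finrank_mul_finrank]
  have h4 : finrank ℚ E = p - 1 := by
    have := D.hp.pos
    rw [mul_comm] at h3
    exact Nat.eq_of_mul_eq_mul_left this h3
  have h5 : finrank ℚ φ.fieldRange = p - 1 := by
    rw [← hK]
    exact (LinearEquiv.finrank_eq (AlgEquiv.ofInjectiveField φ).toLinearEquiv).symm
  have h6 := IntermediateField.eq_of_le_of_finrank_eq h1 (by rw [h4, h5])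
  have := hfix y hy
  rw [← h6] at this
  exact this

theorem hr_units (D : KData p N u ζ α σ δ) {ζK : K} (hζK : IsPrimitiveRoot ζK p)
    (hKgen : Algebra.adjoin ℚ {ζK} = (⊤ : Subalgebra ℚ K))
    (hζζ : algebraMap K L ζK = ζ) (hK : finrank ℚ K = p - 1) (hL : finrank ℚ L = p * (p - 1)) :
    finrank ℤ (Additive (𝓞 L)ˣ) ≤ finrank ℤ (LinearMap.range
      (∑ i ∈ Finset.range p, (uact σ : Module.End ℤ (Additive (𝓞 L)ˣ)) ^ i))
      + (p - 1) * ((p - 1) / 2) := by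
  have hζL : IsPrimitiveRoot (ζ : L) p := by
    rw [← hζζ]; exact hζK.map_of_injective (algebraMap K L).injective
  have hrK := rank_units D.hp2 hζK
  have hrL := rank_units D.hp2 hζL
  rw [hK] at hrK
  rw [hL] at hrL
  let ι : Additive (𝓞 K)ˣ →ₗ[ℤ] Additive (𝓞 L)ˣ :=
    (MonoidHom.toAdditive (Units.map (algebraMap (𝓞 K) (𝓞 L)).toMonoidHom)).toIntLinearMap
  have hι : Function.Injective ι := by
    intro a b hab
    have h1 := congrArg Additive.toMul hab
    have h2 := congrArg Units.val h1
    apply Additive.toMul.injective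
    apply Units.ext
    exact FaithfulSMul.algebraMap_injective (𝓞 K) (𝓞 L) h2
  set f := (∑ i ∈ Finset.range p, (uact σ : Module.End ℤ (Additive (𝓞 L)ˣ)) ^ i) with hf
  have hfix : ∀ (i : ℕ) (x : Additive (𝓞 K)ˣ),
      σ ^ i • ((ι x).toMul : 𝓞 L) = ((ι x).toMul : 𝓞 L) := by
    intro i x
    induction i with
    | zero => simp
    | succ i ih =>
      have h1 : σ • ((ι x).toMul : 𝓞 L) = ((ι x).toMul : 𝓞 L) := by
        apply RingOfIntegers.ext
        rw [coe_smul]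
        exact fix_K hKgen hζζ σ D.σζ (x.toMul : 𝓞 K)
      rw [pow_succ, mul_smul, h1, ih]
  have hfι : ∀ x, f (ι x) = ι (p • x) := by
    intro x
    apply uact_ext
    rw [hf, uact_Nm, map_nsmul]
    simp [Nm, hfix]
  have h1 : finrank ℤ (LinearMap.range (f.comp ι)) ≤ finrank ℤ (LinearMap.range f) :=
    Submodule.finrank_mono (LinearMap.range_comp_le_range ι f)
  have h2 : finrank ℤ (LinearMap.range (f.comp ι)) + finrank ℤ (LinearMap.ker (f.comp ι)) =
      finrank ℤ (Additive (𝓞 K)ˣ) := by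
    rw [← (f.comp ι).quotKerEquivRange.finrank_eq]
    exact Submodule.finrank_quotient_add_finrank _
  have h3 : finrank ℤ (LinearMap.ker (f.comp ι)) = 0 := by
    rw [Module.finrank_eq_zero_iff_isTorsion]
    rintro ⟨x, hx⟩
    rw [LinearMap.mem_ker, LinearMap.comp_apply, hfι] at hx
    have hx' : p • x = 0 := hι (by rw [hx, map_zero])
    refine ⟨⟨(p : ℤ), mem_nonZeroDivisors_of_ne_zero (by exact_mod_cast D.hp.ne_zero)⟩, ?_⟩
    apply Subtype.ext
    change (p : ℤ) • x = 0
    rw [natCast_zsmul, hx']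
  obtain ⟨m, hm⟩ : ∃ m, p = 2 * m + 1 := ⟨(p - 1) / 2, by
    have := D.hp.eq_two_or_odd; have := D.hp2; omega⟩
  have e1 : p - 1 = 2 * m := by omega
  have e2 : (p - 1) / 2 = m := by omega
  rw [e1] at hrK hrL
  rw [e2, e1]
  have e3 : p * (2 * m) = 2 * (2 * m * m + m) := by rw [hm]; ring
  rw [e3] at hrL
  omega
end units
end Kum

end

section
open Module
open scoped Pointwise

namespace Kum
open Polynomial NumberField

section unit2

theorem unit_algebra {O G : Type*} [CommRing O] [IsDomain O] [Group G] [MulSemiringAction G O]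
    (p m r : ℕ) (hm : p = 2 * m + 1) (ζ : O) (hζ : ζ ^ p = 1) (σ : G) (ε η s : Oˣ)
    (hs : s ^ 2 = 1) (hσs : σ • (s : O) = s) (hσ : σ • (ε : O) = ε)
    (h : (ε : O) ^ 2 = s * ζ ^ r * Nm p σ (η : O)) :
    ∃ (j : ℕ) (v : Oˣ), (ε : O) = ζ ^ j * Nm p σ (v : O) := by
  have hfix : ∀ x : O, σ • x = x → Nm p σ x = x ^ p := by
    intro x hx
    have : ∀ i : ℕ, σ ^ i • x = x := by
      intro i
      induction i with
      | zero => simp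
      | succ i ih => rw [pow_succ, mul_smul, hx, ih]
    simp [Nm, this]
  have hs' : (s : O) ^ 2 = 1 := by
    rw [← Units.val_pow_eq_pow_val, hs, Units.val_one]
  have hNs : Nm p σ (s : O) = s := by
    rw [hfix _ hσs, hm, pow_succ, pow_mul, hs', one_pow, one_mul]
  have hNε : Nm p σ (ε : O) = ε * (ε ^ 2) ^ m := by
    rw [hfix _ hσ, hm, pow_succ, pow_mul]; ring
  have hηη : Nm p σ ((η⁻¹ : Oˣ) : O) * Nm p σ (η : O) = 1 := by
    rw [← Nm_mul, ← Units.val_mul, inv_mul_cancel, Units.val_one, Nm_one]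
  refine ⟨(p - 1) * (r * m), s ^ m * ε * η⁻¹ ^ m, ?_⟩
  have hu : IsUnit (((ε : O) ^ 2) ^ m) := (ε.isUnit.pow 2).pow m
  apply hu.mul_right_cancel
  rw [← hNε]
  push_cast
  rw [Nm_mul, Nm_mul, Nm_pow, Nm_pow, hNs]
  conv_rhs => rw [h]
  have e1 : ζ ^ ((p - 1) * (r * m)) * (ζ ^ r) ^ m = 1 := by
    rw [← pow_mul ζ r m, ← pow_add]
    have : (p - 1) * (r * m) + r * m = p * (r * m) := by
      rw [← Nat.succ_mul]; congr 1; omega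
    rw [this, pow_mul, hζ, one_pow]
  have e2 : (s : O) ^ m * (s : O) ^ m = 1 := by rw [← mul_pow, ← sq, hs', one_pow]
  have e3 : Nm p σ ((η⁻¹ : Oˣ) : O) ^ m * Nm p σ (η : O) ^ m = 1 := by
    rw [← mul_pow, hηη, one_pow]
  calc Nm p σ (ε : O) = (ζ ^ ((p - 1) * (r * m)) * (ζ ^ r) ^ m) * ((s : O) ^ m * (s : O) ^ m) *
        (Nm p σ ((η⁻¹ : Oˣ) : O) ^ m * Nm p σ (η : O) ^ m) * Nm p σ (ε : O) := by
        rw [e1, e2, e3]; ring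
    _ = _ := by ring

variable {K L : Type*} [Field K] [NumberField K] [Field L] [NumberField L]
variable {p N : ℕ} [IsGalois ℚ L] [Algebra K L] {ζ α : 𝓞 L} {σ δ : L ≃ₐ[ℚ] L} {u : (ZMod p)ˣ}

theorem conj_K {ζK : K} (hKgen : Algebra.adjoin ℚ {ζK} = (⊤ : Subalgebra ℚ K))
    (hζζ : algebraMap K L ζK = ζ) (n : ℕ) (hn : n ≠ 0) (hζn : ζ ^ n = 1) (κ : L ≃ₐ[ℚ] L) (h : (κ • ζ) * ζ = 1) (ψ : L →+* ℂ) (x : K) :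
    ψ (κ (algebraMap K L x)) = (starRingEnd ℂ) (ψ (algebraMap K L x)) := by
  have h2 : (ψ.comp ((κ : L →+* L).comp (algebraMap K L))).toRatAlgHom
      = ((starRingEnd ℂ).comp (ψ.comp (algebraMap K L))).toRatAlgHom := by
    apply AlgHom.ext_of_adjoin_eq_top hKgen
    intro x hx
    rw [Set.mem_singleton_iff] at hx
    subst hx
    change ψ (κ (algebraMap K L x)) = (starRingEnd ℂ) (ψ (algebraMap K L x))
    rw [hζζ, ← coe_smul]
    have h1 : ψ ((κ • ζ : 𝓞 L) : L) * ψ (ζ : L) = 1 := by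
      rw [← map_mul, ← map_mul, h, map_one, map_one]
    have h3 : ψ (ζ : L) ^ n = 1 := by
      rw [← map_pow, ← map_pow, hζn, map_one, map_one]
    have h4 : ‖ψ (ζ : L)‖ = 1 := Complex.norm_eq_one_of_pow_eq_one h3 hn
    rw [← Complex.inv_eq_conj h4]
    exact eq_inv_of_mul_eq_one_left h1
  exact DFunLike.congr_fun h2 x

theorem hunit_L (D : KData p N u ζ α σ δ) {ζK : K} (hζK : IsPrimitiveRoot ζK p)
    (hKgen : Algebra.adjoin ℚ {ζK} = (⊤ : Subalgebra ℚ K))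
    (hζζ : algebraMap K L ζK = ζ) (hK : finrank ℚ K = p - 1) (hL : finrank ℚ L = p * (p - 1))
    (κ : L ≃ₐ[ℚ] L) (hκ : (κ • ζ) * ζ = 1) (ε η : (𝓞 L)ˣ) (hε : σ • (ε : 𝓞 L) = ε)
    (hεη : (ε : 𝓞 L) * κ • (ε : 𝓞 L) = Nm p σ (η : 𝓞 L)) :
    ∃ (j : ℕ) (v : (𝓞 L)ˣ), (ε : 𝓞 L) = ζ ^ j * Nm p σ (v : 𝓞 L) := by
  obtain ⟨m, hm⟩ : ∃ m, p = 2 * m + 1 := ⟨(p - 1) / 2, by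
    have := D.hp.eq_two_or_odd; have := D.hp2; omega⟩
  have : NeZero p := ⟨D.hp.ne_zero⟩
  obtain ⟨x, hx⟩ := fixed_mem D hKgen hζζ hK hL (ε : L)
    (by rw [← coe_smul, hε])
  have hcyc : IsCyclotomicExtension {p} ℚ K := by
    rw [IsCyclotomicExtension.iff_adjoin_eq_top]
    refine ⟨fun n hn _ => ⟨ζK, by rw [Set.mem_singleton_iff.1 hn]; exact hζK⟩, ?_⟩
    rw [eq_top_iff, ← hKgen]
    apply Algebra.adjoin_mono
    intro z hz
    rw [Set.mem_singleton_iff] at hz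
    subst hz
    exact ⟨p, rfl, D.hp.ne_zero, hζK.pow_eq_one⟩
  let w : 𝓞 L := ε * κ • ((ε⁻¹ : (𝓞 L)ˣ) : 𝓞 L)
  have hκε : κ • (ε : 𝓞 L) * κ • ((ε⁻¹ : (𝓞 L)ˣ) : 𝓞 L) = 1 := by
    rw [← smul_mul', ← Units.val_mul, mul_inv_cancel, Units.val_one, smul_one]
  have hw : w * κ • (ε : 𝓞 L) = ε := by
    change ((ε : 𝓞 L) * κ • ((ε⁻¹ : (𝓞 L)ˣ) : 𝓞 L)) * κ • (ε : 𝓞 L) = ε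
    rw [mul_assoc, mul_comm (κ • ((ε⁻¹ : (𝓞 L)ˣ) : 𝓞 L)), hκε, mul_one]
  have hnorm : ∀ ψ : L →+* ℂ, ‖ψ (w : L)‖ = 1 := by
    intro ψ
    have h1 := congrArg (fun z : 𝓞 L => ψ (z : L)) hw
    simp only [map_mul] at h1
    change ψ (w : L) * ψ (κ (algebraMap (𝓞 L) L ε)) = ψ (algebraMap (𝓞 L) L ε) at h1
    rw [← hx, conj_K hKgen hζζ p D.hp.ne_zero D.hζ.pow_eq_one κ hκ] at h1
    have h2 := congrArg norm h1
    rw [norm_mul, RCLike.norm_conj] at h2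
    have h3 : ‖ψ (algebraMap K L x)‖ ≠ 0 := by
      rw [norm_ne_zero_iff, _root_.map_ne_zero, hx]
      simp
    exact mul_right_cancel₀ h3 (by rw [h2, one_mul])
  obtain ⟨n, hn0, hn⟩ := NumberField.Embeddings.pow_eq_one_of_norm_eq_one L ℂ
    (RingOfIntegers.isIntegral_coe w) hnorm
  have hσκε : σ • κ • (ε : 𝓞 L) = κ • (ε : 𝓞 L) := by
    have h1 : (κ⁻¹ * σ * κ) • ζ = ζ := by
      obtain ⟨k, hk⟩ := D.τζ' κ
      rw [mul_smul, mul_smul, hk, smul_pow', D.σζ, ← hk, inv_smul_smul]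
    have h2 := fix_K hKgen hζζ _ h1 x
    have h3 : (κ⁻¹ * σ * κ) • (ε : 𝓞 L) = ε := by
      apply RingOfIntegers.ext
      change (κ⁻¹ * σ * κ) (algebraMap (𝓞 L) L ε) = algebraMap (𝓞 L) L ε
      rw [← hx, h2]
    rwa [mul_smul, mul_smul, inv_smul_eq_iff] at h3
  have hσw : σ • w = w := by
    have h1 := congrArg (fun z => σ • z) hw
    simp only [smul_mul', hε, hσκε] at h1
    have hu : IsUnit (κ • (ε : 𝓞 L)) := IsUnit.of_mul_eq_one _ hκε
    exact hu.mul_right_cancel (h1.trans hw.symm)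
  obtain ⟨y, hy⟩ := fixed_mem D hKgen hζζ hK hL (w : L) (by rw [← coe_smul, hσw])
  have hyf : IsOfFinOrder y := by
    rw [isOfFinOrder_iff_pow_eq_one]
    refine ⟨n, hn0, (algebraMap K L).injective ?_⟩
    rw [map_pow, hy, hn, map_one]
  obtain ⟨r, -, hr⟩ := hζK.exists_pow_or_neg_mul_pow_of_isOfFinOrder ⟨m, hm⟩ hyf
  have hws : ∃ s : (𝓞 L)ˣ, s ^ 2 = 1 ∧ σ • (s : 𝓞 L) = s ∧ w = s * ζ ^ r := by
    rcases hr with hr | hr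
    · refine ⟨1, by simp, by simp, ?_⟩
      apply RingOfIntegers.ext
      rw [← hy, hr, map_pow, hζζ]; simp
    · refine ⟨-1, by simp, by simp, ?_⟩
      apply RingOfIntegers.ext
      rw [← hy, hr, map_neg, map_pow, hζζ]; simp
  obtain ⟨s, hs1, hs2, hs3⟩ := hws
  apply unit_algebra p m r hm ζ D.hζ.pow_eq_one σ ε η s hs1 hs2 hε
  rw [← hs3, ← hεη]
  calc (ε : 𝓞 L) ^ 2 = ε * ε := sq _
    _ = ε * (w * κ • (ε : 𝓞 L)) := by rw [hw]
    _ = _ := by ring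
end unit2
end Kum

end


namespace Kum
open Module
open scoped Pointwise

theorem pRank_eq (p : ℕ) [hp : Fact p.Prime] (C : Type*) [CommGroup C] [Finite C] :
    pRank p C = finrank (ZMod p) (Tor p C) := by
  rw [pRank, card_tor, Nat.factorization_pow, Finsupp.smul_apply, hp.out.factorization_self]
  simp

theorem ringInt_finrank (E L : Type*) [Field E] [NumberField E] [Field L] [NumberField L]
    [Algebra E L] : finrank (𝓞 E) (𝓞 L) = finrank E L :=
  (IsFractionRing.finrank_eq (𝓞 E) E (𝓞 L) L).symm

theorem final (p N : ℕ) (hp : p.Prime) (hpodd : Odd p) (hN : N.Prime) (hNp : N ≠ p)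
    (hmod : N ≡ 1 [MOD p])
    (K : Type) [Field K] [NumberField K]
    (ζK : K) (hζK : IsPrimitiveRoot ζK p)
    (hKgen : Algebra.adjoin ℚ {ζK} = (⊤ : Subalgebra ℚ K))
    (hreg : ¬ p ∣ Nat.card (ClassGroup (𝓞 K)))
    (F : Type) [Field F] [NumberField F]
    (β : F) (hβ : β ^ p = (N : F))
    (hFgen : Algebra.adjoin ℚ {β} = (⊤ : Subalgebra ℚ F))
    (L : Type) [Field L] [NumberField L]
    (ζ : L) (hζ : IsPrimitiveRoot ζ p)
    (α : L) (hα : α ^ p = (N : L))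
    (hLgen : Algebra.adjoin ℚ {ζ, α} = (⊤ : Subalgebra ℚ L)) :
    4 * pRank p (ClassGroup (𝓞 F)) + p ≤ 2 * pRank p (ClassGroup (𝓞 L)) + 7 := by
  have : Fact p.Prime := ⟨hp⟩
  have hp2 : 2 < p := by
    have := hp.two_le
    rcases hpodd with ⟨m, rfl⟩
    omega
  obtain ⟨hK, φ, hφ⟩ := exists_hom ζK hKgen _ (cyclotomic_eq_minpoly_rat hζK hp.pos).symm ζ
    (by rw [cyclotomic_eq_minpoly_rat hζ hp.pos, minpoly.aeval])
  obtain ⟨hF, φF, hφF⟩ := exists_hom β hFgen _ (minpoly_β p N hp hN β hβ) α (by simp [hα])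
  rw [natDegree_cyclotomic, Nat.totient_prime hp] at hK
  rw [natDegree_X_pow_sub_C] at hF
  letI : Algebra K L := φ.toRingHom.toAlgebra
  letI : Algebra F L := φF.toRingHom.toAlgebra
  have hζζ : algebraMap K L ζK = ζ := hφ
  have hββ : algebraMap F L β = α := hφF
  have hKL := Module.finrank_mul_finrank ℚ K L
  have hFL := Module.finrank_mul_finrank ℚ F L
  rw [hK] at hKL
  rw [hF] at hFL
  have hdeg : p * (p - 1) ∣ finrank ℚ L := by
    apply Nat.Coprime.mul_dvd_of_dvd_of_dvd
    · have := (Nat.coprime_self_sub_right hp.one_le).2 (Nat.coprime_one_right p)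
      exact this
    · exact ⟨_, hFL.symm⟩
    · exact ⟨_, hKL.symm⟩
  obtain ⟨hext, hL, hex⟩ := galois_data hp hζ hα hLgen hN hdeg
  have hGal := isGalois hp hζ hα hLgen hN
  obtain ⟨u, hu⟩ := IsCyclic.exists_generator (α := (ZMod p)ˣ)
  obtain ⟨σ, hσ1, hσ2⟩ := hex 1 1
  obtain ⟨δ, hδ1, hδ2⟩ := hex u 0
  have hζi : IsIntegral ℤ ζ := hζ.isIntegral hp.pos
  have hαi : IsIntegral ℤ α := by
    apply IsIntegral.of_pow hp.pos
    rw [hα]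
    have := isIntegral_algebraMap (R := ℤ) (A := L) (x := (N : ℤ))
    simpa using this
  let z : 𝓞 L := ⟨ζ, hζi⟩
  let a : 𝓞 L := ⟨α, hαi⟩
  have hv1 : (1 : ZMod p).val = 1 := ZMod.val_one p
  have D : KData p N u z a σ δ :=
    { hp := hp
      hp2 := hp2
      hN := hN
      hNp := hNp
      hmod := hmod
      hu := hu
      hζ := IsPrimitiveRoot.of_map_of_injective (f := algebraMap (𝓞 L) L) hζ
        RingOfIntegers.coe_injective
      hα := RingOfIntegers.ext (by
        have h1 : algebraMap (𝓞 L) L (a ^ p) = algebraMap (𝓞 L) L (N : 𝓞 L) := by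
          rw [map_pow, map_natCast]; exact hα
        exact h1)
      σζ := RingOfIntegers.ext (by
        rw [coe_smul]
        change σ ζ = ζ
        rw [hσ1, Units.val_one, hv1, pow_one])
      σα := RingOfIntegers.ext (by
        rw [coe_smul]
        change σ α = ζ * α
        rw [hσ2, hv1, pow_one])
      δζ := RingOfIntegers.ext (by
        rw [coe_smul]
        have h1 : δ ζ = algebraMap (𝓞 L) L (z ^ (u : ZMod p).val) := by
          rw [map_pow]; exact hδ1
        exact h1)
      δα := RingOfIntegers.ext (by
        rw [coe_smul]
        change δ α = α
        rw [hδ2, ZMod.val_zero, pow_zero, one_mul])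
      ext := fun τ h1 h2 => hext τ (congrArg (algebraMap (𝓞 L) L) h1)
        (congrArg (algebraMap (𝓞 L) L) h2) }
  obtain ⟨t, ht⟩ := torsion_gen (L := L)
  have hKL' : finrank K L = p := by
    rw [hL, mul_comm p] at hKL
    exact Nat.eq_of_mul_eq_mul_left (by omega) hKL
  have hFL' : finrank F L = p - 1 := by
    rw [hL] at hFL
    exact Nat.eq_of_mul_eq_mul_left (by omega) hFL
  have hζKi : IsIntegral ℤ ζK := hζK.isIntegral hp.pos
  have hfixF : ∀ x : F, δ (algebraMap F L x) = algebraMap F L x :=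
    fix_K (ζ := a) hFgen hββ δ D.δα
  have hmain := D.main_abstract (Nat.card (ClassGroup (𝓞 K))) hreg
    (fun q hq hαq => D.hw_rel (R := 𝓞 K) (by rw [ringInt_finrank, hKL'])
      ⟨ζK, hζKi⟩ (RingOfIntegers.ext hζζ) q hq hαq)
    t ht (hr_units D hζK hKgen hζζ hK hL)
    (fun κ hκ ε η h1 h2 => hunit_L D hζK hKgen hζζ hK hL κ hκ ε η h1 h2)
  have hrank := ext_rank (R := 𝓞 F) (O := 𝓞 L) (p := p) (by rw [ringInt_finrank, hFL']) δ
    (fun x => RingOfIntegers.ext (hfixF x))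
  rw [pRank_eq, pRank_eq]
  omega
end Kum

/-- Let `p` be a regular prime (odd, not dividing the class number of
`ℚ(ζ_p)`) and `N ≠ p` a prime with `N ≡ 1 (mod p)`; let `F = ℚ(N^{1/p})` and
`L = ℚ(ζ_p, N^{1/p})`.  Then `rk_p(Cl(L)) ≥ 2·rk_p(Cl(F)) + (p-7)/2`, i.e.
`2·rk_p(Cl(L)) ≥ 4·rk_p(Cl(F)) + p - 7` in `ℤ`. -/
theorem stmt13 (p N : ℕ) (hp : p.Prime) (hpodd : Odd p) (hN : N.Prime) (hNp : N ≠ p)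
    (hmod : N ≡ 1 [MOD p])
    (K : Type) [Field K] [NumberField K]
    (ζK : K) (hζK : IsPrimitiveRoot ζK p)
    (hKgen : Algebra.adjoin ℚ {ζK} = (⊤ : Subalgebra ℚ K))
    (hreg : ¬ p ∣ Nat.card (ClassGroup (𝓞 K)))
    (F : Type) [Field F] [NumberField F]
    (β : F) (hβ : β ^ p = (N : F))
    (hFgen : Algebra.adjoin ℚ {β} = (⊤ : Subalgebra ℚ F))
    (L : Type) [Field L] [NumberField L]
    (ζ : L) (hζ : IsPrimitiveRoot ζ p)
    (α : L) (hα : α ^ p = (N : L))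
    (hLgen : Algebra.adjoin ℚ {ζ, α} = (⊤ : Subalgebra ℚ L)) :
    4 * (pRank p (ClassGroup (𝓞 F)) : ℤ) + (p : ℤ) - 7
      ≤ 2 * (pRank p (ClassGroup (𝓞 L)) : ℤ) := by
  have := Kum.final p N hp hpodd hN hNp hmod K ζK hζK hKgen hreg F β hβ hFgen L ζ hζ α hα hLgen
  omega
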